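/- arXiv:math/0209316 — 4 statements merged into one kernel-verified Lean document; each statement's English description precedes it below -/
import Mathlib

section
/- Let 𝒢 be any class of groups. For either the Binary Cycle Test or the Circle Test: if the test is valid for a graph Γ with respect to 𝒢, then it is valid with respect to 𝒢 for every graph homeomorphic to Γ. -/
set_option maxHeartbeats 1000000
set_option synthInstance.maxHeartbeats 400000

attribute [local instance] Classical.propDecidable

noncomputable section

/-- A multigraph: loops and multiple edges are allowed.  Each edge `e` has a
reference orientation, from `src e` to `tgt e`. -/
structure MGraph : Type 1 where
  V : Type
  E : Type
  src : E → V
  tgt : E → V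

/-- A class of groups (a property of groups). -/
abbrev GroupClass : Type 1 := (G : Type) → Group G → Prop

/-- A subgroup-closed class of groups. -/
def SubgroupClosed (𝒢 : GroupClass) : Prop :=
  ∀ (G : Type) [instG : Group G], 𝒢 G instG → ∀ H : Subgroup G, 𝒢 H inferInstance

/-- The number of occurrences of `a` in the list `l`. -/
def countIn {α : Type} (l : List α) (a : α) : ℕ :=
  (l.map fun x => if x = a then 1 else 0).sum

namespace MGraph

/-- A step of a walk: an edge together with a direction of traversal
(`true` = from `src` to `tgt`). -/
abbrev Step (Γ : MGraph) : Type := Γ.E × Bool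

def stepStart (Γ : MGraph) (s : Γ.Step) : Γ.V := if s.2 then Γ.src s.1 else Γ.tgt s.1

def stepEnd (Γ : MGraph) (s : Γ.Step) : Γ.V := if s.2 then Γ.tgt s.1 else Γ.src s.1

/-- `IsWalkFrom Γ a b l`: the list of steps `l` is a walk from `a` to `b`. -/
inductive IsWalkFrom (Γ : MGraph) : Γ.V → Γ.V → List Γ.Step → Prop
  | nil (v : Γ.V) : IsWalkFrom Γ v v []
  | cons {a b : Γ.V} {s : Γ.Step} {l : List Γ.Step} :
      Γ.stepStart s = a → IsWalkFrom Γ (Γ.stepEnd s) b l → IsWalkFrom Γ a b (s :: l)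

section Walks

variable (Γ : MGraph)

/-- The list of edges underlying a walk. -/
def walkEdges (l : List Γ.Step) : List Γ.E := l.map Prod.fst

/-- The list of vertices visited by a walk starting at `a`. -/
def walkVerts (a : Γ.V) (l : List Γ.Step) : List Γ.V := a :: l.map Γ.stepEnd

/-- A closed walk (given as its list of steps) is simple if it is nontrivial and
repeats no edge and no vertex (except that initial vertex = final vertex). -/
def IsSimpleClosed (l : List Γ.Step) : Prop :=
  l ≠ [] ∧ (Γ.walkEdges l).Nodup ∧ (l.map Γ.stepStart).Nodup

section Gain

variable {G : Type} [Group G]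

/-- The gain of a single step, for a gain function `g`. -/
def stepGain (g : Γ.E → G) (s : Γ.Step) : G := if s.2 then g s.1 else (g s.1)⁻¹

/-- The gain of a walk: the product of the gains of its steps, in order. -/
def walkGain (g : Γ.E → G) (l : List Γ.Step) : G := (l.map (Γ.stepGain g)).prod

/-- A gain graph is balanced if every simple closed walk has gain `1`. -/
def IsBalanced (g : Γ.E → G) : Prop :=
  ∀ (v : Γ.V) (l : List Γ.Step),
    Γ.IsWalkFrom v v l → Γ.IsSimpleClosed l → Γ.walkGain g l = 1

end Gain

/-- The mod-2 boundary map from edge chains to vertex chains. -/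
def boundary : (Γ.E →₀ ZMod 2) →ₗ[ZMod 2] (Γ.V →₀ ZMod 2) :=
  Finsupp.lsum (ZMod 2) fun e => Finsupp.lsingle (Γ.src e) + Finsupp.lsingle (Γ.tgt e)

/-- The binary cycle space `Z₁(Γ; ℤ₂)`: mod-2 edge chains with even degree at
every vertex. -/
def cycleSpace : Submodule (ZMod 2) (Γ.E →₀ ZMod 2) := LinearMap.ker Γ.boundary

/-- `B` is a basis of the binary cycle space of `Γ`. -/
def IsCycleBasis (B : Set (Γ.E →₀ ZMod 2)) : Prop :=
  (∀ c ∈ B, c ∈ Γ.cycleSpace) ∧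
  LinearIndependent (ZMod 2) (fun c : B => c.1) ∧
  ∀ c ∈ Γ.cycleSpace, c ∈ Submodule.span (ZMod 2) B

/-- The closed walk `l` is a cyclic orientation of the binary cycle `c`:
it is closed and its edge multiplicities reduced mod 2 give `c`. -/
def IsCyclicOrientation (c : Γ.E →₀ ZMod 2) (l : List Γ.Step) : Prop :=
  (∃ v, Γ.IsWalkFrom v v l) ∧ ∀ e : Γ.E, c e = (countIn (Γ.walkEdges l) e : ZMod 2)

/-- The binary cycle `c` is a circle: it is the (indicator of the) edge set of a
simple closed walk. -/
def IsCircleCycle (c : Γ.E →₀ ZMod 2) : Prop :=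
  ∃ l, Γ.IsSimpleClosed l ∧ Γ.IsCyclicOrientation c l

section Tests

variable {G : Type} [Group G]

/-- `B` passes the Binary Cycle Test: it has a cyclic orientation all of whose
closed walks have gain `1`. -/
def PassesBCT (g : Γ.E → G) (B : Set (Γ.E →₀ ZMod 2)) : Prop :=
  ∀ c ∈ B, ∃ l, Γ.IsCyclicOrientation c l ∧ Γ.walkGain g l = 1

/-- The Binary Cycle Test is valid for the gain graph `(Γ, g, G)`. -/
def BCTValid (g : Γ.E → G) : Prop :=
  (∃ B, Γ.IsCycleBasis B ∧ Γ.PassesBCT g B) → Γ.IsBalanced g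

/-- `c` is a circle whose natural traversal as a simple closed walk has gain 1. -/
def IsBalancedCircleCycle (g : Γ.E → G) (c : Γ.E →₀ ZMod 2) : Prop :=
  ∃ l, Γ.IsSimpleClosed l ∧ Γ.IsCyclicOrientation c l ∧ Γ.walkGain g l = 1

/-- The Circle Test is valid for the gain graph `(Γ, g, G)`: if some basis of the
binary cycle space consists of balanced circles, then the gain graph is balanced. -/
def CircleTestValid (g : Γ.E → G) : Prop :=
  (∃ B, Γ.IsCycleBasis B ∧ ∀ c ∈ B, Γ.IsBalancedCircleCycle g c) → Γ.IsBalanced g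

end Tests

/-- The Binary Cycle Test is valid for `Γ` with respect to the class `𝒢`. -/
def BCTValidFor (𝒢 : GroupClass) : Prop :=
  ∀ (G : Type) [instG : Group G], 𝒢 G instG → ∀ g : Γ.E → G, Γ.BCTValid g

/-- The Circle Test is valid for `Γ` with respect to the class `𝒢`
(`Γ` is a "good" graph for `𝒢`). -/
def CircleTestValidFor (𝒢 : GroupClass) : Prop :=
  ∀ (G : Type) [instG : Group G], 𝒢 G instG → ∀ g : Γ.E → G, Γ.CircleTestValid g

/-- Deletion of a set of edges. -/
def deleteEdges (S : Set Γ.E) : MGraph where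
  V := Γ.V
  E := {e : Γ.E // e ∉ S}
  src e := Γ.src e.1
  tgt e := Γ.tgt e.1

/-- The relation identifying the two endpoints of each edge of `S`. -/
def contractRel (S : Set Γ.E) : Γ.V → Γ.V → Prop :=
  fun x y => ∃ e ∈ S, Γ.src e = x ∧ Γ.tgt e = y

/-- Contraction `Γ/S`: vertices in the same component of `(V, S)` are identified
and the edges of `S` are deleted. -/
def contract (S : Set Γ.E) : MGraph where
  V := Quot (Γ.contractRel S)
  E := {e : Γ.E // e ∉ S}
  src e := Quot.mk _ (Γ.src e.1)
  tgt e := Quot.mk _ (Γ.tgt e.1)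

/-- The subgraph with vertex set `U` and edge set the edges of `T` having both
endpoints in `U`. -/
def subgraph (U : Set Γ.V) (T : Set Γ.E) : MGraph where
  V := U
  E := {e : Γ.E // e ∈ T ∧ Γ.src e ∈ U ∧ Γ.tgt e ∈ U}
  src e := ⟨Γ.src e.1, e.2.2.1⟩
  tgt e := ⟨Γ.tgt e.1, e.2.2.2⟩

/-- The set of vertices incident with an edge of `D`. -/
def edgeVerts (D : Set Γ.E) : Set Γ.V := {x | ∃ e ∈ D, Γ.src e = x ∨ Γ.tgt e = x}

/-- The subgraph spanned by an edge set `D`. -/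
def edgeSubgraph (D : Set Γ.E) : MGraph := Γ.subgraph (Γ.edgeVerts D) D

/-- Adjacency of vertices. -/
def Adj (x y : Γ.V) : Prop :=
  ∃ e : Γ.E, (Γ.src e = x ∧ Γ.tgt e = y) ∨ (Γ.src e = y ∧ Γ.tgt e = x)

/-- A graph with no loops. -/
def Loopless : Prop := ∀ e : Γ.E, Γ.src e ≠ Γ.tgt e

/-- A finite graph. -/
def IsFiniteGraph : Prop := Finite Γ.V ∧ Finite Γ.E

/-- A graph is inseparable if any two distinct edges lie in a common circle. -/
def Inseparable : Prop :=
  ∀ e f : Γ.E, e ≠ f →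
    ∃ (v : Γ.V) (l : List Γ.Step), Γ.IsWalkFrom v v l ∧ Γ.IsSimpleClosed l ∧
      e ∈ Γ.walkEdges l ∧ f ∈ Γ.walkEdges l

/-- `D` is (the edge set of) a block of `Γ`: a maximal inseparable subgraph. -/
def IsBlock (D : Set Γ.E) : Prop :=
  (Γ.edgeSubgraph D).Inseparable ∧
  ∀ D', D ⊆ D' → (Γ.edgeSubgraph D').Inseparable → D' = D

/-- The edge set `D` is a circle of `Γ`. -/
def IsCircleSet (D : Set Γ.E) : Prop :=
  ∃ (v : Γ.V) (l : List Γ.Step), Γ.IsWalkFrom v v l ∧ Γ.IsSimpleClosed l ∧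
    D = {e | e ∈ Γ.walkEdges l}

/-- The edge set `D` is a balanced circle for the gain function `g`. -/
def IsBalancedCircleSet {G : Type} [Group G] (g : Γ.E → G) (D : Set Γ.E) : Prop :=
  Γ.IsCircleSet D ∧
  ∀ (v : Γ.V) (l : List Γ.Step), Γ.IsWalkFrom v v l → Γ.IsSimpleClosed l →
    D = {e | e ∈ Γ.walkEdges l} → Γ.walkGain g l = 1

end Walks

/-- An isomorphism of multigraphs (preserving endpoints as unordered pairs). -/
structure Iso (Γ Δ : MGraph) where
  vEquiv : Γ.V ≃ Δ.V
  eEquiv : Γ.E ≃ Δ.E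
  ends_eq : ∀ e : Γ.E,
    s(Δ.src (eEquiv e), Δ.tgt (eEquiv e)) = s(vEquiv (Γ.src e), vEquiv (Γ.tgt e))

/-- `Δ` is a minor of `Γ`: `Δ` is isomorphic to a subgraph of a contraction of `Γ`. -/
def IsMinor (Δ Γ : MGraph) : Prop :=
  ∃ (S : Set Γ.E) (U : Set (Γ.contract S).V) (T : Set (Γ.contract S).E),
    Nonempty (Iso Δ ((Γ.contract S).subgraph U T))

/-- Subdivision of the edge `e₀` into a path of length two. -/
def subdivide (Γ : MGraph) (e₀ : Γ.E) : MGraph where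
  V := Γ.V ⊕ Unit
  E := Γ.E ⊕ Unit
  src := fun e => match e with
    | .inl e => Sum.inl (Γ.src e)
    | .inr _ => Sum.inr ()
  tgt := fun e => match e with
    | .inl e => if e = e₀ then Sum.inr () else Sum.inl (Γ.tgt e)
    | .inr _ => Sum.inl (Γ.tgt e₀)

/-- One subdivision step (up to isomorphism). -/
def SubdivisionStep (A B : MGraph) : Prop :=
  Nonempty (Iso B A) ∨ ∃ e₀ : A.E, Nonempty (Iso B (A.subdivide e₀))

/-- `Δ` is (isomorphic to) a graph obtained from `Γ₀` by subdividing edges. -/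
def IsSubdivisionOf (Δ Γ₀ : MGraph) : Prop :=
  ∃ Δ', Relation.ReflTransGen SubdivisionStep Γ₀ Δ' ∧ Nonempty (Iso Δ Δ')

/-- Two graphs are homeomorphic if both are obtained by subdividing edges of a
common graph. -/
def Homeomorphic (Γ₁ Γ₂ : MGraph) : Prop :=
  ∃ Γ₀, IsSubdivisionOf Γ₁ Γ₀ ∧ IsSubdivisionOf Γ₂ Γ₀

section Ops

variable (Γ : MGraph)

/-- Interchange `u` and `v`. -/
def twistVert (u v x : Γ.V) : Γ.V := if x = u then v else if x = v then u else x

/-- The result of twisting the edge set `A` across `{u, v}`: every endpoint of an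
edge of `A` at `u` is reconnected to `v` and vice versa. -/
def twist (u v : Γ.V) (A : Set Γ.E) : MGraph where
  V := Γ.V
  E := Γ.E
  src e := if e ∈ A then Γ.twistVert u v (Γ.src e) else Γ.src e
  tgt e := if e ∈ A then Γ.twistVert u v (Γ.tgt e) else Γ.tgt e

/-- `x` and `y` are joined by a walk all of whose vertices avoid `u` and `v`. -/
def AvoidConn (u v x y : Γ.V) : Prop :=
  ∃ l, Γ.IsWalkFrom x y l ∧ ∀ z ∈ Γ.walkVerts x l, z ≠ u ∧ z ≠ v

/-- `P` is the vertex set of a union of some, but not all, of the components of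
`Γ ∖ {u, v}` (the data of a Whitney twist across the 2-separation `{u,v}`). -/
def IsWhitneyTwistData (u v : Γ.V) (P : Set Γ.V) : Prop :=
  (∀ x ∈ P, x ≠ u ∧ x ≠ v) ∧
  (∀ x ∈ P, ∀ y, Γ.AvoidConn u v x y → y ∈ P) ∧
  P.Nonempty ∧ (∃ y : Γ.V, y ∉ P ∧ y ≠ u ∧ y ≠ v)

/-- `(v, w, F)` is valid data for extruding the vertex `v`: `w` is a neighbor of
`v` and `F` is a nonempty set of edges joining `v` and `w`. -/
def IsExtrusionData (v w : Γ.V) (F : Set Γ.E) : Prop :=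
  v ≠ w ∧ F.Nonempty ∧
  ∀ e ∈ F, (Γ.src e = v ∧ Γ.tgt e = w) ∨ (Γ.src e = w ∧ Γ.tgt e = v)

/-- Extrusion of a new vertex `v′` from `v`: the edges of `F` are reattached to
join `v′` to `w`, and a new edge joins `v` to `v′`. -/
def extrude (v w : Γ.V) (F : Set Γ.E) : MGraph where
  V := Γ.V ⊕ Unit
  E := Γ.E ⊕ Unit
  src := fun e => match e with
    | .inl e => if e ∈ F ∧ Γ.src e = v then Sum.inr () else Sum.inl (Γ.src e)
    | .inr _ => Sum.inl v
  tgt := fun e => match e with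
    | .inl e => if e ∈ F ∧ Γ.tgt e = v then Sum.inr () else Sum.inl (Γ.tgt e)
    | .inr _ => Sum.inr ()

end Ops

/-- `Δ` is obtained from `Γ` by extruding a vertex (up to isomorphism). -/
def IsExtrusionOf (Δ Γ : MGraph) : Prop :=
  ∃ (v w : Γ.V) (F : Set Γ.E),
    Γ.IsExtrusionData v w F ∧ Nonempty (Iso Δ (Γ.extrude v w F))

/-- `Γ` is extrusion-irreducible: it is not obtainable by extrusion from a
smaller graph. -/
def ExtrusionIrreducible (Γ : MGraph) : Prop := ¬ ∃ Δ : MGraph, IsExtrusionOf Γ Δ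

/-- `Δ` is obtained from `Γ₀` by a (possibly empty) sequence of extrusions,
up to isomorphism. -/
def ObtainedByExtrusions (Δ Γ₀ : MGraph) : Prop :=
  ∃ Δ', Relation.ReflTransGen (fun A B => IsExtrusionOf B A) Γ₀ Δ' ∧ Nonempty (Iso Δ Δ')

section Bridges

variable (Γ : MGraph)

/-- The walk `l` is internally disjoint from `{u, v}`. -/
def IntDisjWalk (u v : Γ.V) (l : List Γ.Step) : Prop :=
  ∀ z ∈ (l.map Γ.stepEnd).dropLast, z ≠ u ∧ z ≠ v

/-- Two edges lie in a common walk internally disjoint from `{u, v}`. -/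
def InBridgeRel (u v : Γ.V) (e f : Γ.E) : Prop :=
  ∃ (a b : Γ.V) (l : List Γ.Step), Γ.IsWalkFrom a b l ∧ Γ.IntDisjWalk u v l ∧
    e ∈ Γ.walkEdges l ∧ f ∈ Γ.walkEdges l

/-- `D` is (the edge set of) a bridge of `{u, v}`: a maximal set of edges any two
of which lie in a common walk internally disjoint from `{u, v}`. -/
def IsBridge (u v : Γ.V) (D : Set Γ.E) : Prop :=
  D.Nonempty ∧ (∀ e ∈ D, ∀ f ∈ D, Γ.InBridgeRel u v e f) ∧
  ∀ D', D ⊆ D' → (∀ e ∈ D', ∀ f ∈ D', Γ.InBridgeRel u v e f) → D' = D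

/-- The set `A` of vertices is connected using only edges of `D`, within `A`. -/
def SetConnWith (D : Set Γ.E) (A : Set Γ.V) : Prop :=
  ∀ x ∈ A, ∀ y ∈ A, ∃ l, Γ.IsWalkFrom x y l ∧ (∀ s ∈ l, s.1 ∈ D) ∧
    ∀ z ∈ Γ.walkVerts x l, z ∈ A

/-- The subgraph with edge set `D` has `2P_{2uv}` (a four-circle with `u`, `v` as
opposite vertices) as a minor rooted at `u` and `v`, expressed by branch sets. -/
def HasRooted2P2Minor (u v : Γ.V) (D : Set Γ.E) : Prop :=
  ∃ β : Fin 4 → Set Γ.V,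
    (∀ i j, i ≠ j → Disjoint (β i) (β j)) ∧
    (∀ i, (β i).Nonempty ∧ Γ.SetConnWith D (β i)) ∧
    u ∈ β 0 ∧ v ∈ β 2 ∧
    ∀ i : Fin 4, ∃ e ∈ D,
      (Γ.src e ∈ β i ∧ Γ.tgt e ∈ β (i + 1)) ∨ (Γ.src e ∈ β (i + 1) ∧ Γ.tgt e ∈ β i)

/-- Removing the vertex `w` disconnects the subgraph with edge set `D`. -/
def SeparatesBridge (D : Set Γ.E) (w : Γ.V) : Prop :=
  ∃ x ∈ Γ.edgeVerts D, ∃ y ∈ Γ.edgeVerts D, x ≠ w ∧ y ≠ w ∧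
    ¬ ∃ l, Γ.IsWalkFrom x y l ∧ (∀ s ∈ l, s.1 ∈ D) ∧ ∀ z ∈ Γ.walkVerts x l, z ≠ w

end Bridges

/-! ### Particular graphs -/

/-- `K₁°`: one vertex with one loop. -/
@[reducible] def loopGraph : MGraph where
  V := Unit
  E := Unit
  src _ := ()
  tgt _ := ()

/-- `mK₂`: two vertices joined by `m` parallel edges. -/
@[reducible] def banana (m : ℕ) : MGraph where
  V := Bool
  E := Fin m
  src _ := false
  tgt _ := true

/-- `C_l(m₁, …, m_l)`: a circle of length `l` whose `i`-th edge is replaced by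
`m i` parallel copies. -/
@[reducible] def multiCircle (l : ℕ) (m : Fin l → ℕ) : MGraph where
  V := Fin l
  E := Σ i : Fin l, Fin (m i)
  src e := e.1
  tgt e := ⟨(e.1.1 + 1) % l, Nat.mod_lt _ e.1.pos⟩

/-- `2C_n`: the circle of length `n` with every edge doubled. -/
@[reducible] def twoCircle (n : ℕ) : MGraph := multiCircle n fun _ => 2

/-- `K₄(m, m′)`: `K₄` with two opposite (nonadjacent) edges replaced by `m` and
`m′` parallel copies respectively. -/
@[reducible] def K4m (m m' : ℕ) : MGraph where
  V := Fin 4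
  E := (Fin m ⊕ Fin m') ⊕ Fin 4
  src := fun e => match e with
    | .inl (.inl _) => 0
    | .inl (.inr _) => 2
    | .inr j => ![0, 0, 1, 1] j
  tgt := fun e => match e with
    | .inl (.inl _) => 1
    | .inl (.inr _) => 3
    | .inr j => ![2, 3, 2, 3] j

/-- `K₄''`: `K₄` with two adjacent edges doubled. -/
@[reducible] def K4dd : MGraph where
  V := Fin 4
  E := Fin 8
  src := ![0, 0, 0, 0, 0, 1, 1, 2]
  tgt := ![1, 1, 2, 2, 3, 2, 3, 3]

/-- The `n`-spoke wheel `W_n`: rim vertices `Fin n` and a hub; `inl i` is the rim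
edge from `v_i` to `v_{i+1}` and `inr i` is the spoke from the hub to `v_i`. -/
@[reducible] def wheel (n : ℕ) : MGraph where
  V := Fin n ⊕ Unit
  E := Fin n ⊕ Fin n
  src := fun e => match e with
    | .inl i => Sum.inl i
    | .inr _ => Sum.inr ()
  tgt := fun e => match e with
    | .inl i => Sum.inl ⟨(i.1 + 1) % n, Nat.mod_lt _ i.pos⟩
    | .inr i => Sum.inl i

instance (n : ℕ) : Finite ((wheel n).E) := inferInstanceAs (Finite (Fin n ⊕ Fin n))

/-- The indicator of an edge set, as a binary chain. -/
def indicatorCycle (Γ : MGraph) [Finite Γ.E] (D : Set Γ.E) : Γ.E →₀ ZMod 2 :=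
  Finsupp.equivFunOnFinite.symm fun e => if e ∈ D then 1 else 0

/-- The edge set of the Hamiltonian circle of `W_n` omitting the rim edge `r`:
all rim edges except `r`, together with the two spokes at the ends of `r`. -/
def wheelHamSet (n : ℕ) (r : Fin n) : Set (wheel n).E :=
  {e | Sum.elim (fun j : Fin n => j ≠ r)
      (fun j : Fin n => j = r ∨ j = ⟨(r.1 + 1) % n, Nat.mod_lt _ r.pos⟩) e}

/-- The set of (indicators of) the `n` Hamiltonian circles of the wheel `W_n`. -/
def wheelHamBasis (n : ℕ) : Set ((wheel n).E →₀ ZMod 2) :=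
  {c | ∃ r : Fin n, c = indicatorCycle (wheel n) (wheelHamSet n r)}

/-- A theta graph: a graph homeomorphic to a triple link. -/
def IsThetaGraph (Δ : MGraph) : Prop := Homeomorphic Δ (banana 3)

end MGraph

end
namespace MGraph

noncomputable section HomeoInvariance

/-- Two gain graphs are related so that binary cycles and closed walks correspond. -/
def Transfer (A B : MGraph) {G : Type} [Group G] (g : A.E → G) (g' : B.E → G) : Prop :=
  ∃ f : (A.E →₀ ZMod 2) →ₗ[ZMod 2] (B.E →₀ ZMod 2), Function.Injective f ∧
    (∀ c ∈ A.cycleSpace, f c ∈ B.cycleSpace) ∧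
    (∀ c' ∈ B.cycleSpace, ∃ c ∈ A.cycleSpace, f c = c') ∧
    (∀ v l, A.IsWalkFrom v v l → ∃ v' l', B.IsWalkFrom v' v' l' ∧
      (A.IsSimpleClosed l → B.IsSimpleClosed l') ∧
      (A.walkGain g l = 1 ↔ B.walkGain g' l' = 1) ∧
      ∀ c ∈ A.cycleSpace, A.IsCyclicOrientation c l → B.IsCyclicOrientation (f c) l') ∧
    (∀ v' l', B.IsWalkFrom v' v' l' → ∃ v l, A.IsWalkFrom v v l ∧
      (B.IsSimpleClosed l' → A.IsSimpleClosed l) ∧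
      (A.walkGain g l = 1 ↔ B.walkGain g' l' = 1) ∧
      ∀ c ∈ A.cycleSpace, B.IsCyclicOrientation (f c) l' → A.IsCyclicOrientation c l)

theorem Transfer.balanced {A B : MGraph} {G : Type} [Group G] {g : A.E → G} {g' : B.E → G}
    (h : Transfer A B g g') : A.IsBalanced g ↔ B.IsBalanced g' := by
  obtain ⟨f, hinj, h1, h2, h3, h4⟩ := h
  constructor
  · intro hb v' l' hw hs
    obtain ⟨v, l, a1, a2, a3, -⟩ := h4 v' l' hw
    exact a3.1 (hb v l a1 (a2 hs))
  · intro hb v l hw hs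
    obtain ⟨v', l', a1, a2, a3, -⟩ := h3 v l hw
    exact a3.2 (hb v' l' a1 (a2 hs))

theorem cycleBasis_image {A B : MGraph} (f : (A.E →₀ ZMod 2) →ₗ[ZMod 2] (B.E →₀ ZMod 2))
    (hinj : Function.Injective f)
    (h1 : ∀ c ∈ A.cycleSpace, f c ∈ B.cycleSpace)
    (h2 : ∀ c' ∈ B.cycleSpace, ∃ c ∈ A.cycleSpace, f c = c')
    (S : Set (A.E →₀ ZMod 2)) (hS : A.IsCycleBasis S) : B.IsCycleBasis (f '' S) := by
  obtain ⟨b1, b2, b3⟩ := hS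
  refine ⟨?_, ?_, ?_⟩
  · rintro _ ⟨c, hc, rfl⟩
    exact h1 c (b1 c hc)
  · have : LinearIndepOn (ZMod 2) id S := b2
    exact LinearIndepOn.id_image (this.map_injOn f hinj.injOn)
  · intro c' hc'
    obtain ⟨c, hc, rfl⟩ := h2 c' hc'
    rw [← Submodule.map_span]
    exact ⟨c, b3 c hc, rfl⟩

theorem cycleBasis_preimage {A B : MGraph} (f : (A.E →₀ ZMod 2) →ₗ[ZMod 2] (B.E →₀ ZMod 2))
    (hinj : Function.Injective f)
    (h1 : ∀ c ∈ A.cycleSpace, f c ∈ B.cycleSpace)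
    (h2 : ∀ c' ∈ B.cycleSpace, ∃ c ∈ A.cycleSpace, f c = c')
    (S : Set (B.E →₀ ZMod 2)) (hS : B.IsCycleBasis S) :
    A.IsCycleBasis (f ⁻¹' S) := by
  obtain ⟨b1, b2, b3⟩ := hS
  have him : f '' (f ⁻¹' S) = S := by
    rw [Set.image_preimage_eq_iff]
    intro c' hc'
    obtain ⟨c, -, hc⟩ := h2 c' (b1 c' hc')
    exact ⟨c, hc⟩
  refine ⟨?_, ?_, ?_⟩
  · intro c hc
    obtain ⟨d, hd, hdc⟩ := h2 _ (b1 _ hc)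
    rwa [← hinj hdc]
  · have h : LinearIndepOn (ZMod 2) id S := b2
    rw [← him] at h
    have h' : LinearIndepOn (ZMod 2) (f ∘ id) (f ⁻¹' S) :=
      (linearIndepOn_iff_image (R := ZMod 2) (f := f) hinj.injOn).2 h
    exact LinearIndepOn.of_comp f (v := id) h'
  · intro c hc
    have := b3 _ (h1 c hc)
    rw [← him, ← Submodule.map_span] at this
    obtain ⟨d, hd, hdc⟩ := this
    rwa [← hinj hdc]

theorem Transfer.bct {A B : MGraph} {G : Type} [Group G] {g : A.E → G} {g' : B.E → G}
    (h : Transfer A B g g') : A.BCTValid g ↔ B.BCTValid g' := by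
  have hbal := h.balanced
  obtain ⟨f, hinj, h1, h2, h3, h4⟩ := h
  constructor
  · rintro hv ⟨S, hS, hp⟩
    have hb := cycleBasis_preimage f hinj h1 h2 S hS
    refine hbal.1 (hv ⟨_, hb, ?_⟩)
    intro c hc
    obtain ⟨l', ho, hg⟩ := hp _ hc
    obtain ⟨v', hw⟩ := ho.1
    obtain ⟨v, l, a1, a2, a3, a4⟩ := h4 v' l' hw
    exact ⟨l, a4 c (hb.1 c hc) ho, a3.2 hg⟩
  · rintro hv ⟨S, hS, hp⟩
    have hb := cycleBasis_image f hinj h1 h2 S hS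
    refine hbal.2 (hv ⟨_, hb, ?_⟩)
    rintro _ ⟨c, hc, rfl⟩
    obtain ⟨l, ho, hg⟩ := hp _ hc
    obtain ⟨v, hw⟩ := ho.1
    obtain ⟨v', l', a1, a2, a3, a4⟩ := h3 v l hw
    exact ⟨l', a4 c (hS.1 c hc) ho, a3.1 hg⟩

theorem Transfer.circle {A B : MGraph} {G : Type} [Group G] {g : A.E → G} {g' : B.E → G}
    (h : Transfer A B g g') : A.CircleTestValid g ↔ B.CircleTestValid g' := by
  have hbal := h.balanced
  obtain ⟨f, hinj, h1, h2, h3, h4⟩ := h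
  constructor
  · rintro hv ⟨S, hS, hp⟩
    have hb := cycleBasis_preimage f hinj h1 h2 S hS
    refine hbal.1 (hv ⟨_, hb, ?_⟩)
    intro c hc
    obtain ⟨l', hs, ho, hg⟩ := hp _ hc
    obtain ⟨v', hw⟩ := ho.1
    obtain ⟨v, l, a1, a2, a3, a4⟩ := h4 v' l' hw
    exact ⟨l, a2 hs, a4 c (hb.1 c hc) ho, a3.2 hg⟩
  · rintro hv ⟨S, hS, hp⟩
    have hb := cycleBasis_image f hinj h1 h2 S hS
    refine hbal.2 (hv ⟨_, hb, ?_⟩)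
    rintro _ ⟨c, hc, rfl⟩
    obtain ⟨l, hs, ho, hg⟩ := hp _ hc
    obtain ⟨v, hw⟩ := ho.1
    obtain ⟨v', l', a1, a2, a3, a4⟩ := h3 v l hw
    exact ⟨l', a2 hs, a4 c (hS.1 c hc) ho, a3.1 hg⟩

/-- Every gain function on one graph transfers to the other and conversely. -/
def TransferRel (A B : MGraph) : Prop :=
  ∀ (G : Type) [Group G],
    (∀ g : A.E → G, ∃ g' : B.E → G, Transfer A B g g') ∧
    (∀ g' : B.E → G, ∃ g : A.E → G, Transfer A B g g')

/-- Validity of both tests agrees. -/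
def SameTests (𝒢 : GroupClass) (A B : MGraph) : Prop :=
  (A.BCTValidFor 𝒢 ↔ B.BCTValidFor 𝒢) ∧ (A.CircleTestValidFor 𝒢 ↔ B.CircleTestValidFor 𝒢)

theorem TransferRel.same {A B : MGraph} (h : TransferRel A B) (𝒢 : GroupClass) :
    SameTests 𝒢 A B := by
  refine ⟨⟨?_, ?_⟩, ⟨?_, ?_⟩⟩
  · intro hv G _ hG g'
    obtain ⟨g, hg⟩ := (h G).2 g'
    exact hg.bct.1 (hv G hG g)
  · intro hv G _ hG g
    obtain ⟨g', hg⟩ := (h G).1 g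
    exact hg.bct.2 (hv G hG g')
  · intro hv G _ hG g'
    obtain ⟨g, hg⟩ := (h G).2 g'
    exact hg.circle.1 (hv G hG g)
  · intro hv G _ hG g
    obtain ⟨g', hg⟩ := (h G).1 g
    exact hg.circle.2 (hv G hG g')

theorem countIn_nil' {α : Type} (a : α) : countIn [] a = 0 := rfl

theorem countIn_cons' {α : Type} (x : α) (l : List α) (a : α) :
    countIn (x :: l) a = (if x = a then 1 else 0) + countIn l a := by
  simp [countIn]

theorem isWalk_cons_iff {Γ : MGraph} {a b : Γ.V} {s : Γ.Step} {l : List Γ.Step} :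
    Γ.IsWalkFrom a b (s :: l) ↔ Γ.stepStart s = a ∧ Γ.IsWalkFrom (Γ.stepEnd s) b l := by
  constructor
  · intro h
    cases h with
    | cons h1 h2 => exact ⟨h1, h2⟩
  · rintro ⟨h1, h2⟩
    exact .cons h1 h2

theorem isWalk_nil_iff {Γ : MGraph} {a b : Γ.V} : Γ.IsWalkFrom a b [] ↔ a = b := by
  constructor
  · intro h
    cases h
    rfl
  · rintro rfl
    exact .nil _

theorem walkGain_cons {Γ : MGraph} {G : Type} [Group G] (g : Γ.E → G) (s : Γ.Step)
    (l : List Γ.Step) : Γ.walkGain g (s :: l) = Γ.stepGain g s * Γ.walkGain g l := by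
  simp [walkGain]

theorem walkGain_append {Γ : MGraph} {G : Type} [Group G] (g : Γ.E → G)
    (l m : List Γ.Step) : Γ.walkGain g (l ++ m) = Γ.walkGain g l * Γ.walkGain g m := by
  simp [walkGain]

theorem walkGain_nil {Γ : MGraph} {G : Type} [Group G] (g : Γ.E → G) :
    Γ.walkGain g [] = 1 := by
  simp [walkGain]

theorem IsWalkFrom.append {Γ : MGraph} {a b c : Γ.V} {l m : List Γ.Step}
    (h : Γ.IsWalkFrom a b l) (h' : Γ.IsWalkFrom b c m) : Γ.IsWalkFrom a c (l ++ m) := by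
  induction h with
  | nil v => exact h'
  | cons h1 h2 ih => exact .cons h1 (ih h')

/-- Starts and ends of a walk agree up to the two extremities. -/
theorem IsWalkFrom.perm {Γ : MGraph} {a b : Γ.V} {l : List Γ.Step}
    (h : Γ.IsWalkFrom a b l) : (l.map Γ.stepStart ++ [b]) = (a :: l.map Γ.stepEnd) := by
  induction h with
  | nil v => rfl
  | cons h1 h2 ih => simp [h1, ih]

theorem mem_start_iff_mem_end {Γ : MGraph} {a : Γ.V} {l : List Γ.Step}
    (h : Γ.IsWalkFrom a a l) (x : Γ.V) (hx : x ∈ l.map Γ.stepStart) : x ∈ l.map Γ.stepEnd := by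
  have hp : (l.map Γ.stepStart).Perm (l.map Γ.stepEnd) := by
    have := h.perm
    have h2 : (a :: l.map Γ.stepStart).Perm (a :: l.map Γ.stepEnd) := by
      rw [← this]
      exact (List.perm_append_singleton _ _).symm
    exact (List.perm_cons a).1 h2
  exact hp.mem_iff.1 hx

/-! #### Isomorphisms -/

section IsoPart

variable {A B : MGraph} (φ : Iso A B)

/-- Whether the isomorphism reverses the reference orientation of `e`. -/
def isoKeep (e : A.E) : Bool :=
  decide (B.src (φ.eEquiv e) = φ.vEquiv (A.src e) ∧ B.tgt (φ.eEquiv e) = φ.vEquiv (A.tgt e))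

theorem isoKeep_true {e : A.E} (h : isoKeep φ e = true) :
    B.src (φ.eEquiv e) = φ.vEquiv (A.src e) ∧ B.tgt (φ.eEquiv e) = φ.vEquiv (A.tgt e) := by
  simpa [isoKeep] using h

theorem isoKeep_false {e : A.E} (h : isoKeep φ e = false) :
    B.src (φ.eEquiv e) = φ.vEquiv (A.tgt e) ∧ B.tgt (φ.eEquiv e) = φ.vEquiv (A.src e) := by
  have h' : ¬ (B.src (φ.eEquiv e) = φ.vEquiv (A.src e) ∧
      B.tgt (φ.eEquiv e) = φ.vEquiv (A.tgt e)) := by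
    simpa only [isoKeep, decide_eq_false_iff_not] using h
  have := φ.ends_eq e
  rw [Sym2.eq_iff] at this
  tauto

/-- The induced bijection on steps. -/
def isoStep (s : A.Step) : B.Step := (φ.eEquiv s.1, s.2 == isoKeep φ s.1)

/-- Its inverse. -/
def isoStepInv (s : B.Step) : A.Step :=
  (φ.eEquiv.symm s.1, s.2 == isoKeep φ (φ.eEquiv.symm s.1))

theorem isoStep_inv (s : B.Step) : isoStep φ (isoStepInv φ s) = s := by
  obtain ⟨e, b⟩ := s
  cases b <;> cases h : isoKeep φ (φ.eEquiv.symm e) <;> simp [isoStep, isoStepInv, h]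

theorem isoStep_start (s : A.Step) : B.stepStart (isoStep φ s) = φ.vEquiv (A.stepStart s) := by
  obtain ⟨e, b⟩ := s
  cases h : isoKeep φ e
  · have := isoKeep_false φ h
    cases b <;> simp [isoStep, stepStart, h, this]
  · have := isoKeep_true φ h
    cases b <;> simp [isoStep, stepStart, h, this]

theorem isoStep_end (s : A.Step) : B.stepEnd (isoStep φ s) = φ.vEquiv (A.stepEnd s) := by
  obtain ⟨e, b⟩ := s
  cases h : isoKeep φ e
  · have := isoKeep_false φ h
    cases b <;> simp [isoStep, stepEnd, h, this]
  · have := isoKeep_true φ h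
    cases b <;> simp [isoStep, stepEnd, h, this]

theorem isoStep_walk (l : List A.Step) (a b : A.V) :
    B.IsWalkFrom (φ.vEquiv a) (φ.vEquiv b) (l.map (isoStep φ)) ↔ A.IsWalkFrom a b l := by
  induction l generalizing a with
  | nil => simp [isWalk_nil_iff]
  | cons s l ih => simp [isWalk_cons_iff, isoStep_start, isoStep_end, ih]

theorem isoStep_simple (l : List A.Step) :
    B.IsSimpleClosed (l.map (isoStep φ)) ↔ A.IsSimpleClosed l := by
  have h1 : B.walkEdges (l.map (isoStep φ)) = (A.walkEdges l).map φ.eEquiv := by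
    simp [walkEdges, isoStep]
  have h2 : (l.map (isoStep φ)).map B.stepStart = (l.map A.stepStart).map φ.vEquiv := by
    simp [isoStep_start]
  unfold IsSimpleClosed
  rw [h1, h2, List.nodup_map_iff φ.eEquiv.injective, List.nodup_map_iff φ.vEquiv.injective]
  simp

theorem isoStep_count (l : List A.Step) (e : A.E) :
    countIn (B.walkEdges (l.map (isoStep φ))) (φ.eEquiv e) = countIn (A.walkEdges l) e := by
  induction l with
  | nil => rfl
  | cons s l ih =>
    simp only [walkEdges, List.map_cons, countIn_cons'] at ih ⊢
    rw [ih]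
    simp [isoStep]

theorem isoStep_gain {G : Type} [Group G] (g : A.E → G) (g' : B.E → G)
    (h : ∀ e, g e = if isoKeep φ e then g' (φ.eEquiv e) else (g' (φ.eEquiv e))⁻¹)
    (l : List A.Step) : B.walkGain g' (l.map (isoStep φ)) = A.walkGain g l := by
  induction l with
  | nil => rfl
  | cons s l ih =>
    rw [List.map_cons, walkGain_cons, walkGain_cons, ih]
    congr 1
    obtain ⟨e, b⟩ := s
    cases b <;> cases hk : isoKeep φ e <;> simp [isoStep, stepGain, h, hk]

theorem iso_boundary (c : A.E →₀ ZMod 2) :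
    B.boundary (Finsupp.lmapDomain (ZMod 2) (ZMod 2) φ.eEquiv c) =
      Finsupp.lmapDomain (ZMod 2) (ZMod 2) φ.vEquiv (A.boundary c) := by
  have : B.boundary ∘ₗ Finsupp.lmapDomain (ZMod 2) (ZMod 2) φ.eEquiv =
      Finsupp.lmapDomain (ZMod 2) (ZMod 2) φ.vEquiv ∘ₗ A.boundary := by
    refine Finsupp.lhom_ext fun e b => ?_
    cases h : isoKeep φ e
    · have := isoKeep_false φ h
      simp [boundary, Finsupp.mapDomain_single, Finsupp.mapDomain_add, this, add_comm]
    · have := isoKeep_true φ h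
      simp [boundary, Finsupp.mapDomain_single, Finsupp.mapDomain_add, this]
  exact LinearMap.congr_fun this c

theorem iso_transfer {G : Type} [Group G] (g : A.E → G) (g' : B.E → G)
    (h : ∀ e, g e = if isoKeep φ e then g' (φ.eEquiv e) else (g' (φ.eEquiv e))⁻¹) :
    Transfer A B g g' := by
  have hor : ∀ (c : A.E →₀ ZMod 2) (l : List A.Step),
      A.IsCyclicOrientation c l ↔ B.IsCyclicOrientation
        (Finsupp.lmapDomain (ZMod 2) (ZMod 2) φ.eEquiv c) (l.map (isoStep φ)) := by
    intro c l
    unfold IsCyclicOrientation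
    refine and_congr ?_ ?_
    · rw [← φ.vEquiv.exists_congr_right]
      exact exists_congr fun v => (isoStep_walk φ l v v).symm
    · rw [← φ.eEquiv.forall_congr_right]
      refine forall_congr' fun e => ?_
      rw [isoStep_count, Finsupp.lmapDomain_apply, Finsupp.mapDomain_apply φ.eEquiv.injective]
  refine ⟨Finsupp.lmapDomain (ZMod 2) (ZMod 2) φ.eEquiv,
    Finsupp.mapDomain_injective φ.eEquiv.injective, ?_, ?_, ?_, ?_⟩
  · intro c hc
    have hc' : A.boundary c = 0 := hc
    show B.boundary _ = 0
    rw [iso_boundary, hc', map_zero]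
  · intro c' hc'
    have hcc : Finsupp.lmapDomain (ZMod 2) (ZMod 2) φ.eEquiv
        (Finsupp.lmapDomain (ZMod 2) (ZMod 2) φ.eEquiv.symm c') = c' := by
      simp [← Finsupp.mapDomain_comp]
    refine ⟨Finsupp.lmapDomain (ZMod 2) (ZMod 2) φ.eEquiv.symm c', ?_, hcc⟩
    have hb : B.boundary c' = 0 := hc'
    show A.boundary _ = 0
    rw [← hcc, iso_boundary] at hb
    exact Finsupp.mapDomain_injective φ.vEquiv.injective (hb.trans Finsupp.mapDomain_zero.symm)
  · intro v l hw
    exact ⟨φ.vEquiv v, l.map (isoStep φ), (isoStep_walk φ l v v).2 hw,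
      (isoStep_simple φ l).2, by rw [isoStep_gain φ g g' h], fun c _ => (hor c l).1⟩
  · intro v' l' hw
    obtain ⟨v, rfl⟩ := φ.vEquiv.surjective v'
    obtain ⟨l, rfl⟩ : ∃ l, l.map (isoStep φ) = l' :=
      ⟨l'.map (isoStepInv φ), by simp [Function.comp_def, isoStep_inv]⟩
    exact ⟨v, l, (isoStep_walk φ l v v).1 hw,
      (isoStep_simple φ l).1, by rw [isoStep_gain φ g g' h], fun c _ => (hor c l).2⟩

theorem iso_transferRel (φ : Iso A B) : TransferRel A B := by
  intro G _
  constructor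
  · intro g
    refine ⟨fun e' => if isoKeep φ (φ.eEquiv.symm e') then g (φ.eEquiv.symm e')
      else (g (φ.eEquiv.symm e'))⁻¹, iso_transfer φ _ _ ?_⟩
    intro e
    cases h : isoKeep φ e <;> simp [h]
  · intro g'
    exact ⟨_, iso_transfer φ _ g' fun e => rfl⟩

end IsoPart

/-! #### Subdivision -/

/-- `B` is obtained from `A` by subdividing `e₀` (abstract description). -/
structure SubData (A B : MGraph) (e₀ : A.E) where
  iE : A.E → B.E
  nE : B.E
  iV : A.V → B.V
  nV : B.V
  rE : B.E → Option A.E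
  rV : B.V → A.V
  iE_inj : Function.Injective iE
  iV_inj : Function.Injective iV
  iE_ne : ∀ e, iE e ≠ nE
  iV_ne : ∀ v, iV v ≠ nV
  casesE : ∀ e', e' = nE ∨ ∃ e, e' = iE e
  rE_i : ∀ e, rE (iE e) = some e
  rE_n : rE nE = none
  rV_i : ∀ v, rV (iV v) = v
  rV_n : rV nV = A.tgt e₀
  src_i : ∀ e, B.src (iE e) = iV (A.src e)
  src_n : B.src nE = nV
  tgt_n : B.tgt nE = iV (A.tgt e₀)
  tgt_self : B.tgt (iE e₀) = nV
  tgt_ne : ∀ e, e ≠ e₀ → B.tgt (iE e) = iV (A.tgt e)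

/-- The concrete subdivision satisfies the abstract description. -/
def subDataOf (A : MGraph) (e₀ : A.E) : SubData A (A.subdivide e₀) e₀ where
  iE := (Sum.inl : A.E → A.E ⊕ Unit)
  nE := (Sum.inr () : A.E ⊕ Unit)
  iV := (Sum.inl : A.V → A.V ⊕ Unit)
  nV := (Sum.inr () : A.V ⊕ Unit)
  rE := Sum.elim some (fun _ => none)
  rV := Sum.elim id (fun _ => A.tgt e₀)
  iE_inj := Sum.inl_injective
  iV_inj := Sum.inl_injective
  iE_ne := fun _ => Sum.inl_ne_inr
  iV_ne := fun _ => Sum.inl_ne_inr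
  casesE := by
    rintro (e | u)
    · exact Or.inr ⟨e, rfl⟩
    · exact Or.inl rfl
  rE_i := fun _ => rfl
  rE_n := rfl
  rV_i := fun _ => rfl
  rV_n := rfl
  src_i := fun _ => rfl
  src_n := rfl
  tgt_n := rfl
  tgt_self := if_pos rfl
  tgt_ne := fun _ h => if_neg h

section SubdivPart

variable {A B : MGraph} {e₀ : A.E} (D : SubData A B e₀)

/-- The path replacing a step. -/
def subBlock (s : A.Step) : List B.Step :=
  if s.1 = e₀ then
    (if s.2 then [(D.iE e₀, true), (D.nE, true)] else [(D.nE, false), (D.iE e₀, false)])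
  else [(D.iE s.1, s.2)]

/-- Contraction of the new edge on steps. -/
def subStep (s : B.Step) : Option A.Step := (D.rE s.1).map fun e => (e, s.2)

theorem subStep_i (e : A.E) (b : Bool) : subStep D (D.iE e, b) = some (e, b) := by
  simp [subStep, D.rE_i]

theorem subStep_n (b : Bool) : subStep D (D.nE, b) = none := by
  simp [subStep, D.rE_n]

/-- The chain map. -/
def subChain : (A.E →₀ ZMod 2) →ₗ[ZMod 2] (B.E →₀ ZMod 2) :=
  Finsupp.lmapDomain (ZMod 2) (ZMod 2) D.iE + (Finsupp.lsingle D.nE) ∘ₗ Finsupp.lapply e₀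

theorem subChain_apply (c : A.E →₀ ZMod 2) :
    subChain D c = Finsupp.mapDomain D.iE c + Finsupp.single D.nE (c e₀) := rfl

theorem subChain_i (c : A.E →₀ ZMod 2) (e : A.E) : subChain D c (D.iE e) = c e := by
  rw [subChain_apply, Finsupp.add_apply, Finsupp.mapDomain_apply D.iE_inj,
    Finsupp.single_eq_of_ne (D.iE_ne e), add_zero]

theorem subChain_n (c : A.E →₀ ZMod 2) : subChain D c D.nE = c e₀ := by
  rw [subChain_apply, Finsupp.add_apply, Finsupp.mapDomain_of_notMem_range,
    Finsupp.single_eq_same, zero_add]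
  rintro ⟨e, he⟩
  exact D.iE_ne e he

theorem subChain_injective : Function.Injective (subChain D) := by
  intro c d h
  ext e
  rw [← subChain_i D c, h, subChain_i]

theorem boundary_single (Γ : MGraph) (e : Γ.E) (b : ZMod 2) :
    Γ.boundary (Finsupp.single e b) =
      Finsupp.single (Γ.src e) b + Finsupp.single (Γ.tgt e) b := by
  simp [boundary]

theorem sub_boundary (c : A.E →₀ ZMod 2) :
    B.boundary (subChain D c) = Finsupp.lmapDomain (ZMod 2) (ZMod 2) D.iV (A.boundary c) := by
  have : B.boundary ∘ₗ subChain D =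
      Finsupp.lmapDomain (ZMod 2) (ZMod 2) D.iV ∘ₗ A.boundary := by
    refine Finsupp.lhom_ext fun e b => ?_
    rw [LinearMap.comp_apply, LinearMap.comp_apply, subChain_apply, Finsupp.mapDomain_single,
      map_add, boundary_single, boundary_single, boundary_single, map_add,
      D.src_i, D.src_n, D.tgt_n]
    simp only [Finsupp.lmapDomain_apply, Finsupp.mapDomain_single]
    by_cases he : e = e₀
    · subst he
      rw [D.tgt_self, Finsupp.single_eq_same]
      have h2 : (Finsupp.single D.nV b) + Finsupp.single D.nV b = 0 := by
        rw [← Finsupp.single_add, CharTwo.add_self_eq_zero, Finsupp.single_zero]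
      rw [add_assoc, ← add_assoc (Finsupp.single D.nV b), h2, zero_add]
    · rw [D.tgt_ne e he, Finsupp.single_eq_of_ne (Ne.symm he)]
      simp
  exact LinearMap.congr_fun this c

theorem sub_boundary_n (c : B.E →₀ ZMod 2) :
    B.boundary c D.nV = c (D.iE e₀) + c D.nE := by
  have : Finsupp.lapply D.nV ∘ₗ B.boundary =
      (Finsupp.lapply (D.iE e₀) + Finsupp.lapply D.nE :
        (B.E →₀ ZMod 2) →ₗ[ZMod 2] ZMod 2) := by
    refine Finsupp.lhom_ext fun e b => ?_
    rw [LinearMap.comp_apply, boundary_single, LinearMap.add_apply]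
    simp only [Finsupp.lapply_apply, Finsupp.add_apply]
    rcases D.casesE e with rfl | ⟨e, rfl⟩
    · rw [D.src_n, D.tgt_n]
      simp [Finsupp.single_apply, D.iV_ne, (D.iE_ne _).symm]
    · by_cases he : e = e₀
      · subst he
        rw [D.src_i, D.tgt_self]
        simp [Finsupp.single_apply, D.iV_ne, D.iE_ne]
      · rw [D.src_i, D.tgt_ne e he]
        simp [Finsupp.single_apply, D.iV_ne, D.iE_ne, D.iE_inj.eq_iff, he]
  exact LinearMap.congr_fun this c

theorem sub_edges_count_i (l : List A.Step) (e : A.E) :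
    countIn (B.walkEdges (l.flatMap (subBlock D))) (D.iE e) = countIn (A.walkEdges l) e := by
  induction l with
  | nil => rfl
  | cons s l ih =>
    obtain ⟨e', b⟩ := s
    simp only [walkEdges, List.flatMap_cons, List.map_append, List.map_cons, countIn_cons'] at ih ⊢
    by_cases he : e' = e₀
    · subst he
      cases b <;> simp [subBlock, countIn_cons', ih, D.iE_inj.eq_iff, (D.iE_ne _).symm]
    · simp [subBlock, he, countIn_cons', ih, D.iE_inj.eq_iff]

theorem sub_edges_count_n (l : List A.Step) :
    countIn (B.walkEdges (l.flatMap (subBlock D))) D.nE = countIn (A.walkEdges l) e₀ := by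
  induction l with
  | nil => rfl
  | cons s l ih =>
    obtain ⟨e', b⟩ := s
    simp only [walkEdges, List.flatMap_cons, List.map_append, List.map_cons, countIn_cons'] at ih ⊢
    by_cases he : e' = e₀
    · subst he
      cases b <;> simp [subBlock, countIn_cons', ih, D.iE_ne]
    · simp [subBlock, he, countIn_cons', ih, D.iE_ne]

theorem sub_contract_count (l : List B.Step) (e : A.E) :
    countIn (A.walkEdges (l.filterMap (subStep D))) e = countIn (B.walkEdges l) (D.iE e) := by
  induction l with
  | nil => rfl
  | cons s l ih =>
    obtain ⟨e', b⟩ := s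
    rcases D.casesE e' with rfl | ⟨e', rfl⟩
    · rw [List.filterMap_cons_none (subStep_n D b), ih]
      simp [walkEdges, countIn_cons', (D.iE_ne _).symm]
    · rw [List.filterMap_cons_some (subStep_i D e' b)]
      simp only [walkEdges, List.map_cons, countIn_cons'] at ih ⊢
      rw [ih]
      simp [D.iE_inj.eq_iff]

theorem subBlock_walk (s : A.Step) :
    B.IsWalkFrom (D.iV (A.stepStart s)) (D.iV (A.stepEnd s)) (subBlock D s) := by
  obtain ⟨e, b⟩ := s
  by_cases he : e = e₀
  · subst he
    cases b <;> simp [subBlock, isWalk_cons_iff, isWalk_nil_iff, stepStart, stepEnd,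
      D.src_i, D.src_n, D.tgt_n, D.tgt_self]
  · cases b <;> simp [subBlock, he, isWalk_cons_iff, isWalk_nil_iff, stepStart, stepEnd,
      D.src_i, D.tgt_ne e he]

theorem sub_walk {a b : A.V} {l : List A.Step} (h : A.IsWalkFrom a b l) :
    B.IsWalkFrom (D.iV a) (D.iV b) (l.flatMap (subBlock D)) := by
  induction h with
  | nil v => exact .nil _
  | @cons a b s l h1 h2 ih =>
    rw [List.flatMap_cons, ← h1]
    exact (subBlock_walk D s).append ih

/-- The gain induced on the original graph. -/
def subGain {G : Type} [Group G] (g' : B.E → G) (e : A.E) : G :=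
  if e = e₀ then g' (D.iE e₀) * g' D.nE else g' (D.iE e)

/-- The switching function. -/
def subSwitch {G : Type} [Group G] (g' : B.E → G) (x : B.V) : G :=
  if x = D.nV then g' D.nE else 1

theorem sub_gain {G : Type} [Group G] (g' : B.E → G) (l : List A.Step) :
    B.walkGain g' (l.flatMap (subBlock D)) = A.walkGain (subGain D g') l := by
  induction l with
  | nil => rfl
  | cons s l ih =>
    rw [List.flatMap_cons, walkGain_append, walkGain_cons, ih]
    congr 1
    obtain ⟨e, b⟩ := s
    by_cases he : e = e₀
    · subst he
      cases b <;> simp [subBlock, walkGain, stepGain, subGain]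
    · cases b <;> simp [subBlock, walkGain, stepGain, subGain, he]

theorem subBlock_edges (s : A.Step) (x : B.E) (hx : x ∈ (subBlock D s).map Prod.fst) :
    x = D.iE s.1 ∨ (s.1 = e₀ ∧ x = D.nE) := by
  obtain ⟨e, b⟩ := s
  by_cases he : e = e₀
  · subst he
    cases b <;> simp [subBlock] at hx ⊢ <;> tauto
  · simp [subBlock, he] at hx ⊢
    tauto

theorem subBlock_starts (s : A.Step) (x : B.V) (hx : x ∈ (subBlock D s).map B.stepStart) :
    x = D.iV (A.stepStart s) ∨ (s.1 = e₀ ∧ x = D.nV) := by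
  obtain ⟨e, b⟩ := s
  by_cases he : e = e₀
  · subst he
    cases b <;> simp [subBlock, stepStart, D.src_i, D.src_n, D.tgt_n, D.tgt_self] at hx ⊢ <;>
      tauto
  · cases b <;> simp [subBlock, he, stepStart, D.src_i, D.tgt_ne e he] at hx ⊢ <;> tauto

theorem sub_simple {l : List A.Step} (h : A.IsSimpleClosed l) :
    B.IsSimpleClosed (l.flatMap (subBlock D)) := by
  obtain ⟨h1, h2, h3⟩ := h
  have hp2 : l.Pairwise (fun s t => s.1 ≠ t.1) := List.pairwise_map.1 h2
  have hp3 : l.Pairwise (fun s t => A.stepStart s ≠ A.stepStart t) := List.pairwise_map.1 h3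
  refine ⟨?_, ?_, ?_⟩
  · cases l with
    | nil => exact absurd rfl h1
    | cons s l =>
      obtain ⟨e, b⟩ := s
      by_cases he : e = e₀ <;> cases b <;> simp [subBlock, he]
  · rw [walkEdges, List.map_flatMap, List.nodup_flatMap]
    refine ⟨?_, hp2.imp ?_⟩
    · rintro ⟨e, b⟩ -
      by_cases he : e = e₀ <;> cases b <;> simp [subBlock, he, D.iE_ne, (D.iE_ne _).symm]
    · intro s t hst x hx hx'
      rcases subBlock_edges D s x hx with h | ⟨h, h'⟩ <;>
        rcases subBlock_edges D t x hx' with k | ⟨k, k'⟩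
      · exact hst (D.iE_inj (h.symm.trans k))
      · exact D.iE_ne _ (h.symm.trans k')
      · exact D.iE_ne _ (k.symm.trans h')
      · exact hst (h.trans k.symm)
  · rw [List.map_flatMap, List.nodup_flatMap]
    refine ⟨?_, (hp2.and hp3).imp ?_⟩
    · rintro ⟨e, b⟩ -
      by_cases he : e = e₀
      · subst he
        cases b <;> simp [subBlock, stepStart, D.src_i, D.src_n, D.tgt_n, D.tgt_self, D.iV_ne]
      · simp [subBlock, he]
    · rintro s t ⟨hst, hst'⟩ x hx hx'
      rcases subBlock_starts D s x hx with h | ⟨h, h'⟩ <;>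
        rcases subBlock_starts D t x hx' with k | ⟨k, k'⟩
      · exact hst' (D.iV_inj (h.symm.trans k))
      · exact D.iV_ne _ (h.symm.trans k')
      · exact D.iV_ne _ (k.symm.trans h')
      · exact hst (h.trans k.symm)

theorem sub_contract_ends (e : A.E) (b : Bool) :
    A.stepStart (e, b) = D.rV (B.stepStart (D.iE e, b)) ∧
    A.stepEnd (e, b) = D.rV (B.stepEnd (D.iE e, b)) := by
  by_cases he : e = e₀
  · subst he
    cases b <;> simp [stepStart, stepEnd, D.src_i, D.tgt_self, D.rV_i, D.rV_n]
  · cases b <;> simp [stepStart, stepEnd, D.src_i, D.tgt_ne e he, D.rV_i]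

theorem sub_contract_walk {a b : B.V} {l : List B.Step} (h : B.IsWalkFrom a b l) :
    A.IsWalkFrom (D.rV a) (D.rV b) (l.filterMap (subStep D)) := by
  induction h with
  | nil v => exact .nil _
  | @cons a b s l h1 h2 ih =>
    obtain ⟨e, d⟩ := s
    rcases D.casesE e with rfl | ⟨e, rfl⟩
    · rw [List.filterMap_cons_none (subStep_n D d)]
      have : D.rV a = D.rV (B.stepEnd (D.nE, d)) := by
        rw [← h1]
        cases d <;> simp [stepStart, stepEnd, D.src_n, D.tgt_n, D.rV_i, D.rV_n]
      rw [this]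
      exact ih
    · rw [List.filterMap_cons_some (subStep_i D e d), isWalk_cons_iff]
      obtain ⟨k1, k2⟩ := sub_contract_ends D e d
      rw [k1, k2, h1]
      exact ⟨rfl, ih⟩

theorem sub_contract_gain {G : Type} [Group G] (g' : B.E → G) {a b : B.V} {l : List B.Step}
    (h : B.IsWalkFrom a b l) :
    A.walkGain (subGain D g') (l.filterMap (subStep D)) =
      (subSwitch D g' a)⁻¹ * B.walkGain g' l * subSwitch D g' b := by
  induction h with
  | nil v => simp [walkGain]
  | @cons a b s l h1 h2 ih =>
    rw [walkGain_cons]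
    have key : ∀ x y : G, x = (subSwitch D g' a)⁻¹ * B.stepGain g' s *
        subSwitch D g' (B.stepEnd s) →
        y = (subSwitch D g' (B.stepEnd s))⁻¹ * B.walkGain g' l * subSwitch D g' b →
        x * y = (subSwitch D g' a)⁻¹ * (B.stepGain g' s * B.walkGain g' l) *
          subSwitch D g' b := by
      rintro _ _ rfl rfl
      group
    obtain ⟨e, d⟩ := s
    rcases D.casesE e with rfl | ⟨e, rfl⟩
    · rw [List.filterMap_cons_none (subStep_n D d), ← one_mul (A.walkGain _ _)]
      refine key _ _ ?_ ih
      rw [← h1]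
      cases d <;> simp [stepGain, stepStart, stepEnd, D.src_n, D.tgt_n, subSwitch, D.iV_ne]
    · rw [List.filterMap_cons_some (subStep_i D e d), walkGain_cons]
      refine key _ _ ?_ ih
      rw [← h1]
      by_cases he : e = e₀
      · subst he
        cases d <;> simp [stepGain, stepStart, stepEnd, D.src_i, D.tgt_self, subSwitch,
          subGain, D.iV_ne]
      · cases d <;> simp [stepGain, stepStart, stepEnd, D.src_i, D.tgt_ne e he, subSwitch,
          subGain, he, D.iV_ne]

theorem subStep_eq_some {s : B.Step} {t : A.Step} (h : subStep D s = some t) :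
    s = (D.iE t.1, t.2) := by
  obtain ⟨e, b⟩ := s
  rcases D.casesE e with rfl | ⟨e, rfl⟩
  · rw [subStep_n] at h
    simp at h
  · rw [subStep_i, Option.some.injEq] at h
    subst h
    rfl

/-- In a simple closed walk, a step leaving the new vertex along `e₀` is accompanied by
the reversed new edge. -/
theorem sub_new_mem {v : B.V} {l : List B.Step}
    (hw : B.IsWalkFrom v v l) (hs : B.IsSimpleClosed l)
    (h : (D.iE e₀, false) ∈ l) : (D.nE, false) ∈ l := by
  have hx : D.nV ∈ l.map B.stepStart :=
    List.mem_map.2 ⟨_, h, D.tgt_self⟩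
  have hy := mem_start_iff_mem_end hw _ hx
  obtain ⟨t, ht, hte⟩ := List.mem_map.1 hy
  obtain ⟨e, b⟩ := t
  rcases D.casesE e with rfl | ⟨e, rfl⟩
  · cases b
    · exact ht
    · simp [stepEnd, D.tgt_n, D.iV_ne] at hte
  · exfalso
    cases b
    · simp [stepEnd, D.src_i, D.iV_ne] at hte
    · by_cases he : e = e₀
      · subst he
        have := List.inj_on_of_nodup_map hs.2.1 h ht rfl
        simp at this
      · simp [stepEnd, D.tgt_ne e he, D.iV_ne] at hte

theorem sub_start_of_ne (t : A.Step) (hte : t ≠ (e₀, false)) :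
    B.stepStart (D.iE t.1, t.2) = D.iV (A.stepStart t) := by
  obtain ⟨e, b⟩ := t
  cases b
  · have he : e ≠ e₀ := fun h => hte (by rw [h])
    simp [stepStart, D.tgt_ne e he]
  · simp [stepStart, D.src_i]

theorem sub_contract_clash {v : B.V} {l : List B.Step}
    (hw : B.IsWalkFrom v v l) (hs : B.IsSimpleClosed l)
    (s t : A.Step) (hsl : (D.iE s.1, s.2) ∈ l) (htl : (D.iE t.1, t.2) ∈ l)
    (h : A.stepStart s = A.stepStart t) (hse : s = (e₀, false)) : s = t := by
  subst hse
  by_contra hne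
  have hnew := sub_new_mem D hw hs hsl
  have hst := sub_start_of_ne D t (fun h => hne h.symm)
  have hst' : B.stepStart (D.nE, false) = B.stepStart (D.iE t.1, t.2) := by
    rw [hst, ← h]
    simp [stepStart, D.tgt_n]
  have := List.inj_on_of_nodup_map hs.2.2 hnew htl hst'
  exact (D.iE_ne _).symm (congrArg Prod.fst this)

theorem sub_contract_simple {v : B.V} {l : List B.Step}
    (hw : B.IsWalkFrom v v l) (hs : B.IsSimpleClosed l) :
    A.IsSimpleClosed (l.filterMap (subStep D)) := by
  have hmem : ∀ s : A.Step, s ∈ l.filterMap (subStep D) → (D.iE s.1, s.2) ∈ l := by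
    intro s hs
    obtain ⟨a, ha, h⟩ := List.mem_filterMap.1 hs
    rwa [← subStep_eq_some D h]
  have hnd : (l.filterMap (subStep D)).Nodup := by
    refine List.Nodup.filterMap ?_ (List.Nodup.of_map _ hs.2.1)
    intro a a' b hb hb'
    rw [subStep_eq_some D hb, subStep_eq_some D hb']
  refine ⟨?_, ?_, ?_⟩
  · intro hnil
    have hall : ∀ s ∈ l, s.1 = D.nE := by
      rintro ⟨e, b⟩ hsl
      rcases D.casesE e with rfl | ⟨e, rfl⟩
      · rfl
      · have : (e, b) ∈ l.filterMap (subStep D) :=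
          List.mem_filterMap.2 ⟨_, hsl, subStep_i D e b⟩
        rw [hnil] at this
        simp at this
    obtain ⟨h1, h2, h3⟩ := hs
    match l, h1 with
    | [s], _ =>
      obtain ⟨e, b⟩ := s
      have he : e = D.nE := hall (e, b) (by simp)
      subst he
      rw [isWalk_cons_iff, isWalk_nil_iff] at hw
      have := hw.1.trans hw.2.symm
      cases b
      · simp [stepStart, stepEnd, D.src_n, D.tgt_n, D.iV_ne] at this
      · simp [stepStart, stepEnd, D.src_n, D.tgt_n, (D.iV_ne _).symm] at this
    | s :: t :: l, _ =>
      have e1 := hall s (by simp)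
      have e2 := hall t (by simp)
      simp [walkEdges, e1, e2] at h2
  · refine hnd.map_on ?_
    intro s hsl t htl hst
    have := List.inj_on_of_nodup_map hs.2.1 (hmem s hsl) (hmem t htl) (congrArg D.iE hst)
    exact Prod.ext hst (Prod.mk.inj this).2
  · refine hnd.map_on ?_
    intro s hsl t htl hst
    by_cases h1 : s = (e₀, false)
    · exact sub_contract_clash D hw hs s t (hmem s hsl) (hmem t htl) hst h1
    by_cases h2 : t = (e₀, false)
    · exact (sub_contract_clash D hw hs t s (hmem t htl) (hmem s hsl) hst.symm h2).symm
    have := List.inj_on_of_nodup_map hs.2.2 (hmem s hsl) (hmem t htl)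
      (by rw [sub_start_of_ne D s h1, sub_start_of_ne D t h2, hst])
    exact Prod.ext (D.iE_inj (Prod.mk.inj this).1) (Prod.mk.inj this).2

theorem sub_transfer {G : Type} [Group G] (g' : B.E → G) :
    Transfer A B (subGain D g') g' := by
  refine ⟨subChain D, subChain_injective D, ?_, ?_, ?_, ?_⟩
  · intro c hc
    have hc' : A.boundary c = 0 := hc
    show B.boundary _ = 0
    rw [sub_boundary, hc', map_zero]
  · intro c' hc'
    have hb : B.boundary c' = 0 := hc'
    let c : A.E →₀ ZMod 2 := Finsupp.comapDomain D.iE c' D.iE_inj.injOn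
    have hcv : ∀ e, c e = c' (D.iE e) := fun e => rfl
    have hcc : subChain D c = c' := by
      refine Finsupp.ext fun e => ?_
      rcases D.casesE e with rfl | ⟨e, rfl⟩
      · rw [subChain_n, hcv]
        have := sub_boundary_n D c'
        rw [hb] at this
        exact CharTwo.add_eq_zero.1 this.symm
      · exact subChain_i D c e
    refine ⟨c, ?_, hcc⟩
    rw [← hcc, sub_boundary] at hb
    exact Finsupp.mapDomain_injective D.iV_inj (hb.trans Finsupp.mapDomain_zero.symm)
  · intro v l hw
    refine ⟨_, _, sub_walk D hw, sub_simple D, by rw [sub_gain], ?_⟩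
    intro c _ ho
    refine ⟨⟨_, sub_walk D hw⟩, ?_⟩
    intro e
    rcases D.casesE e with rfl | ⟨e, rfl⟩
    · rw [sub_edges_count_n, subChain_n, ho.2]
    · rw [sub_edges_count_i, subChain_i, ho.2]
  · intro v' l' hw
    refine ⟨_, _, sub_contract_walk D hw, sub_contract_simple D hw, ?_, ?_⟩
    · rw [sub_contract_gain D g' hw, mul_assoc, inv_mul_eq_one]
      constructor
      · intro h
        exact right_eq_mul.1 h
      · intro h
        rw [h, one_mul]
    · intro c _ ho
      refine ⟨⟨_, sub_contract_walk D hw⟩, ?_⟩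
      intro e
      rw [sub_contract_count, ← subChain_i D c e]
      exact ho.2 _

theorem sub_transferRel (D : SubData A B e₀) : TransferRel A B := by
  intro G _
  constructor
  · intro g
    let g' : B.E → G := fun e' => ((D.rE e').map g).getD 1
    refine ⟨g', ?_⟩
    have : subGain D g' = g := by
      funext e
      by_cases he : e = e₀
      · subst he
        simp [subGain, g', D.rE_i, D.rE_n]
      · simp [subGain, g', he, D.rE_i]
    have h := sub_transfer D g'
    rwa [this] at h
  · intro g'
    exact ⟨_, sub_transfer D g'⟩

end SubdivPart

theorem SameTests.symm {𝒢 : GroupClass} {A B : MGraph} (h : SameTests 𝒢 A B) :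
    SameTests 𝒢 B A := ⟨h.1.symm, h.2.symm⟩

theorem SameTests.trans {𝒢 : GroupClass} {A B C : MGraph} (h : SameTests 𝒢 A B)
    (h' : SameTests 𝒢 B C) : SameTests 𝒢 A C := ⟨h.1.trans h'.1, h.2.trans h'.2⟩

theorem subdivisionStep_same (𝒢 : GroupClass) {A B : MGraph} (h : SubdivisionStep A B) :
    SameTests 𝒢 A B := by
  rcases h with ⟨⟨φ⟩⟩ | ⟨e₀, ⟨φ⟩⟩
  · exact ((iso_transferRel φ).same 𝒢).symm
  · exact ((sub_transferRel (subDataOf A e₀)).same 𝒢).trans ((iso_transferRel φ).same 𝒢).symm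

theorem isSubdivisionOf_same (𝒢 : GroupClass) {Δ Γ : MGraph} (h : IsSubdivisionOf Δ Γ) :
    SameTests 𝒢 Γ Δ := by
  obtain ⟨Δ', hr, ⟨φ⟩⟩ := h
  refine SameTests.trans (B := Δ') ?_ ((iso_transferRel φ).same 𝒢).symm
  clear φ
  induction hr with
  | refl => exact ⟨Iff.rfl, Iff.rfl⟩
  | tail _ hs ih => exact ih.trans (subdivisionStep_same 𝒢 hs)

end HomeoInvariance

end MGraph

/-- For either test: validity for a graph `Γ` with respect to a
class `𝒢` of groups carries over to every graph homeomorphic to `Γ`. -/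
theorem tests_homeomorphism_invariant (𝒢 : GroupClass) (Γ Δ : MGraph)
    (h : MGraph.Homeomorphic Γ Δ) :
    (Γ.BCTValidFor 𝒢 → Δ.BCTValidFor 𝒢) ∧
    (Γ.CircleTestValidFor 𝒢 → Δ.CircleTestValidFor 𝒢) := by
  obtain ⟨Γ₀, h1, h2⟩ := h
  have hs := (MGraph.isSubdivisionOf_same 𝒢 h1).symm.trans (MGraph.isSubdivisionOf_same 𝒢 h2)
  exact ⟨hs.1.1, hs.2.1⟩
end

section
/- Let 𝒢 be a subgroup-closed class of groups and Γ a loopless graph for which the Circle Test is valid with respect to 𝒢. Then any graph obtained from Γ by extruding a vertex also has the Circle Test valid with respect to 𝒢. -/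
set_option maxHeartbeats 1000000
set_option synthInstance.maxHeartbeats 400000

attribute [local instance] Classical.propDecidable

noncomputable section

namespace MGraph

namespace Extr

theorem walk_append {Γ : MGraph} {a b c : Γ.V} {l₁ l₂ : List Γ.Step}
    (h₁ : Γ.IsWalkFrom a b l₁) (h₂ : Γ.IsWalkFrom b c l₂) : Γ.IsWalkFrom a c (l₁ ++ l₂) := by
  induction h₁ with
  | nil v => simpa using h₂
  | cons hs _ ih => exact IsWalkFrom.cons hs (ih h₂)

theorem walk_cons {Γ : MGraph} {a b : Γ.V} {s : Γ.Step} {l : List Γ.Step}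
    (h : Γ.IsWalkFrom a b (s :: l)) : Γ.stepStart s = a := by
  cases h with
  | cons hs _ => exact hs

theorem walk_split {Γ : MGraph} {c : Γ.V} {l₂ : List Γ.Step} (l₁ : List Γ.Step) :
    ∀ a : Γ.V, Γ.IsWalkFrom a c (l₁ ++ l₂) →
      ∃ b, Γ.IsWalkFrom a b l₁ ∧ Γ.IsWalkFrom b c l₂ := by
  induction l₁ with
  | nil => intro a h; exact ⟨a, IsWalkFrom.nil a, h⟩
  | cons s l ih =>
    intro a h
    cases h with
    | cons hs h' =>
      obtain ⟨b, h1, h2⟩ := ih _ h'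
      exact ⟨b, IsWalkFrom.cons hs h1, h2⟩

section

variable {Γ : MGraph} {v w : Γ.V} {F : Set Γ.E}

/-- Vertex projection: the new vertex is sent to `v`. -/
def pv (v : Γ.V) : Γ.V ⊕ Unit → Γ.V := Sum.elim id (fun _ => v)

/-- Step projection: steps along the new edge vanish. -/
def ps : ((Γ.E ⊕ Unit) × Bool) → Option Γ.Step
  | (.inl e, b) => some (e, b)
  | (.inr _, _) => none

/-- Projection of walks. -/
def pw (l : List (Γ.extrude v w F).Step) : List Γ.Step := l.filterMap ps

theorem pw_inl (e : Γ.E) (d : Bool) (l : List (Γ.extrude v w F).Step) :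
    pw (((Sum.inl e, d) : (Γ.extrude v w F).Step) :: l) = (e, d) :: pw l := rfl

theorem pw_inr (u : Unit) (d : Bool) (l : List (Γ.extrude v w F).Step) :
    pw (((Sum.inr u, d) : (Γ.extrude v w F).Step) :: l) = pw l := rfl

theorem pw_nil : pw ([] : List (Γ.extrude v w F).Step) = [] := rfl

/-- The switching function. -/
def pot {G : Type} [Group G] (t : G) : Γ.V ⊕ Unit → G := Sum.elim (fun _ => 1) (fun _ => t)

/-- The induced gain function on `Γ`. -/
def hg {G : Type} [Group G] (g : (Γ.extrude v w F).E → G) : Γ.E → G := fun e =>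
  pot (Γ := Γ) (g (Sum.inr ())) ((Γ.extrude v w F).src (Sum.inl e)) * g (Sum.inl e) *
    (pot (Γ := Γ) (g (Sum.inr ())) ((Γ.extrude v w F).tgt (Sum.inl e)))⁻¹

theorem pv_src (e : Γ.E) : pv v ((Γ.extrude v w F).src (Sum.inl e)) = Γ.src e := by
  simp only [extrude]
  split_ifs with h
  · simp [pv, h.2]
  · simp [pv]

theorem pv_tgt (e : Γ.E) : pv v ((Γ.extrude v w F).tgt (Sum.inl e)) = Γ.tgt e := by
  simp only [extrude]
  split_ifs with h
  · simp [pv, h.2]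
  · simp [pv]

theorem pv_start (e : Γ.E) (b : Bool) :
    Γ.stepStart (e, b) = pv v ((Γ.extrude v w F).stepStart (Sum.inl e, b)) := by
  cases b
  · exact (pv_tgt e).symm
  · exact (pv_src e).symm

theorem pv_end (e : Γ.E) (b : Bool) :
    Γ.stepEnd (e, b) = pv v ((Γ.extrude v w F).stepEnd (Sum.inl e, b)) := by
  cases b
  · exact (pv_src e).symm
  · exact (pv_tgt e).symm

theorem pv_new (u : Unit) (b : Bool) :
    pv v ((Γ.extrude v w F).stepStart (Sum.inr u, b)) =
      pv v ((Γ.extrude v w F).stepEnd (Sum.inr u, b)) := by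
  cases b <;> rfl

theorem pw_walk {a b : (Γ.extrude v w F).V} {l : List (Γ.extrude v w F).Step}
    (h : (Γ.extrude v w F).IsWalkFrom a b l) : Γ.IsWalkFrom (pv v a) (pv v b) (pw l) := by
  induction h with
  | nil x => exact IsWalkFrom.nil _
  | @cons a b s l hs _ ih =>
    subst hs
    obtain ⟨e | u, d⟩ := s
    · refine IsWalkFrom.cons (s := (e, d)) (pv_start e d) ?_
      rw [pv_end (v := v) (w := w) (F := F)]
      exact ih
    · rw [pv_new]
      exact ih

theorem gain_step {G : Type} [Group G] (g : (Γ.extrude v w F).E → G) (e : Γ.E) (d : Bool) :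
    Γ.stepGain (hg g) (e, d) =
      pot (Γ := Γ) (g (Sum.inr ())) ((Γ.extrude v w F).stepStart (Sum.inl e, d)) *
      (Γ.extrude v w F).stepGain g (Sum.inl e, d) *
      (pot (Γ := Γ) (g (Sum.inr ())) ((Γ.extrude v w F).stepEnd (Sum.inl e, d)))⁻¹ := by
  cases d <;> simp [stepGain, hg, stepStart, stepEnd, mul_assoc]

theorem gain_new {G : Type} [Group G] (g : (Γ.extrude v w F).E → G) (u : Unit) (d : Bool) :
      pot (Γ := Γ) (g (Sum.inr ())) ((Γ.extrude v w F).stepStart (Sum.inr u, d)) *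
      (Γ.extrude v w F).stepGain g (Sum.inr u, d) *
      (pot (Γ := Γ) (g (Sum.inr ())) ((Γ.extrude v w F).stepEnd (Sum.inr u, d)))⁻¹ = 1 := by
  cases d <;> simp [stepGain, stepStart, stepEnd, pot, extrude]

theorem pw_gain {G : Type} [Group G] (g : (Γ.extrude v w F).E → G)
    {a b : (Γ.extrude v w F).V} {l : List (Γ.extrude v w F).Step}
    (h : (Γ.extrude v w F).IsWalkFrom a b l) :
    Γ.walkGain (hg g) (pw l) = pot (Γ := Γ) (g (Sum.inr ())) a *
      (Γ.extrude v w F).walkGain g l * (pot (Γ := Γ) (g (Sum.inr ())) b)⁻¹ := by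
  induction h with
  | nil x => simp [pw_nil, walkGain]
  | @cons a b s l hs _ ih =>
    subst hs
    have h2 : (Γ.extrude v w F).walkGain g (s :: l) =
      (Γ.extrude v w F).stepGain g s * (Γ.extrude v w F).walkGain g l := by simp [walkGain]
    rw [h2]
    obtain ⟨e | u, d⟩ := s
    · have h1 : Γ.walkGain (hg g) (pw ((Sum.inl e, d) :: l)) =
        Γ.stepGain (hg g) (e, d) * Γ.walkGain (hg g) (pw l) := by
          rw [pw_inl]; simp [walkGain]
      rw [h1, ih, gain_step]
      group
    · have h1 : Γ.walkGain (hg g) (pw ((Sum.inr u, d) :: l)) =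
        1 * Γ.walkGain (hg g) (pw l) := by
          rw [pw_inr]; simp [walkGain]
      rw [h1, ih, ← gain_new g u d]
      group

theorem pw_count (l : List (Γ.extrude v w F).Step) (e : Γ.E) :
    countIn (Γ.walkEdges (pw l)) e =
      countIn ((Γ.extrude v w F).walkEdges l) (Sum.inl e : Γ.E ⊕ Unit) := by
  induction l with
  | nil => rfl
  | cons s l ih =>
    have key : countIn ((Γ.extrude v w F).walkEdges (s :: l)) (Sum.inl e : Γ.E ⊕ Unit) =
      (if (s.1 : Γ.E ⊕ Unit) = Sum.inl e then 1 else 0) +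
        countIn ((Γ.extrude v w F).walkEdges l) (Sum.inl e : Γ.E ⊕ Unit) := by
      simp [countIn, walkEdges]
    rw [key, ← ih]
    obtain ⟨f | u, d⟩ := s
    · rw [pw_inl]; simp [countIn, walkEdges, -Sum.inl.injEq]
      exact if_congr Sum.inl_injective.eq_iff.symm rfl rfl
    · rw [pw_inr]; simp [countIn, walkEdges]

theorem start_inr (hF : Γ.IsExtrusionData v w F) (e : Γ.E) (d : Bool)
    (h : (Γ.extrude v w F).stepStart (Sum.inl e, d) = Sum.inr ()) :
    (Γ.extrude v w F).stepEnd (Sum.inl e, d) = Sum.inl w := by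
  obtain ⟨hvw, -, hF⟩ := hF
  cases d
  · simp only [stepStart, stepEnd, extrude] at h ⊢
    by_cases hc : e ∈ F ∧ Γ.tgt e = v
    · rcases hF e hc.1 with h1 | h1
      · exact absurd (hc.2.symm.trans h1.2) hvw
      · simp [h1.1, hvw.symm]
    · simp [hc] at h
  · simp only [stepStart, stepEnd, extrude] at h ⊢
    by_cases hc : e ∈ F ∧ Γ.src e = v
    · rcases hF e hc.1 with h1 | h1
      · simp [h1.2, hvw.symm]
      · exact absurd (hc.2.symm.trans h1.1) hvw
    · simp [hc] at h

theorem end_inr (hF : Γ.IsExtrusionData v w F) (e : Γ.E) (d : Bool)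
    (h : (Γ.extrude v w F).stepEnd (Sum.inl e, d) = Sum.inr ()) :
    (Γ.extrude v w F).stepStart (Sum.inl e, d) = Sum.inl w := by
  have := start_inr hF e (!d) (by cases d <;> exact h)
  cases d <;> exact this

theorem end_inr_new (u : Unit) (d : Bool)
    (h : (Γ.extrude v w F).stepEnd (Sum.inr u, d) = Sum.inr ()) :
    (Γ.extrude v w F).stepStart (Sum.inr u, d) = Sum.inl v := by
  cases d
  · simp [stepEnd, extrude] at h
  · rfl

theorem no_bad (hF : Γ.IsExtrusionData v w F) {a : (Γ.extrude v w F).V}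
    {l : List (Γ.extrude v w F).Step} (hw : (Γ.extrude v w F).IsWalkFrom a a l)
    (hn : (l.map (Γ.extrude v w F).stepStart).Nodup)
    {e₁ e₂ : Γ.E} {d₁ d₂ : Bool}
    (h₁ : ((Sum.inl e₁, d₁) : (Γ.extrude v w F).Step) ∈ l)
    (h₂ : ((Sum.inl e₂, d₂) : (Γ.extrude v w F).Step) ∈ l)
    (hs₁ : (Γ.extrude v w F).stepStart (Sum.inl e₁, d₁) = Sum.inl v)
    (hs₂ : (Γ.extrude v w F).stepStart (Sum.inl e₂, d₂) = Sum.inr ()) : False := by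
  obtain ⟨l₁, l₂, rfl⟩ := List.append_of_mem h₂
  obtain ⟨b, hw1, hw2⟩ := walk_split l₁ a hw
  cases hw2 with
  | cons hb hw3 =>
  rw [hs₂] at hb
  subst hb
  rw [start_inr hF e₂ d₂ hs₂] at hw3
  have hw4 := walk_append hw3 hw1
  have hperm : (l₁ ++ ((Sum.inl e₂, d₂) : (Γ.extrude v w F).Step) :: l₂).Perm
      (((Sum.inl e₂, d₂) : (Γ.extrude v w F).Step) :: (l₂ ++ l₁)) := by
    refine List.perm_middle.trans (List.Perm.cons _ List.perm_append_comm)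
  have hn' := (hperm.map (Γ.extrude v w F).stepStart).nodup_iff.mp hn
  have hm := hperm.mem_iff.mp h₁
  generalize l₂ ++ l₁ = m at *
  have hm' : ((Sum.inl e₁, d₁) : (Γ.extrude v w F).Step) ∈ m := by
    rcases List.mem_cons.mp hm with h | h
    · rw [h, hs₂] at hs₁
      cases hs₁
    · exact h
  have hnm : (m.map (Γ.extrude v w F).stepStart).Nodup := by
    rw [List.map_cons] at hn'
    exact hn'.of_cons
  have hinj := List.inj_on_of_nodup_map hnm
  rcases List.eq_nil_or_concat m with rfl | ⟨m', s₀, rfl⟩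
  · simp at hm'
  rw [List.concat_eq_append] at *
  obtain ⟨b, hw5, hw6⟩ := walk_split m' _ hw4
  cases hw6 with
  | cons hb hw7 =>
  have hend : (Γ.extrude v w F).stepEnd s₀ = Sum.inr () := by
    generalize (Γ.extrude v w F).stepEnd s₀ = z at hw7
    cases hw7
    rfl
  obtain ⟨f | u, d⟩ := s₀
  · have hst := end_inr hF f d hend
    cases m' with
    | nil =>
      simp only [List.nil_append, List.mem_singleton] at hm'
      rw [← hm', hs₁] at hst
      exact hF.1 (Sum.inl.inj hst)
    | cons s m'' =>
      have hc := walk_cons hw5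
      simp [hc, hst] at hnm
      exact (List.nodup_cons.mp hnm).1 (List.mem_append_right _ (List.mem_singleton.mpr rfl))
  · have hst := end_inr_new u d hend
    have := hinj hm' (by simp : ((Sum.inr u, d) : (Γ.extrude v w F).Step) ∈ _)
      (hs₁.trans hst.symm)
    cases this

theorem pw_simple (hF : Γ.IsExtrusionData v w F) {a : (Γ.extrude v w F).V}
    {l : List (Γ.extrude v w F).Step} (hw : (Γ.extrude v w F).IsWalkFrom a a l)
    (hs : (Γ.extrude v w F).IsSimpleClosed l) : Γ.IsSimpleClosed (pw l) := by
  obtain ⟨h0, he, hn⟩ := hs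
  have hmem : ∀ {e : Γ.E} {d : Bool}, (e, d) ∈ pw l →
      ((Sum.inl e, d) : (Γ.extrude v w F).Step) ∈ l := by
    intro e d h
    obtain ⟨⟨f | u, d'⟩, hm, hp⟩ := List.mem_filterMap.mp h
    · simp only [ps, Option.some.injEq, Prod.mk.injEq] at hp
      obtain ⟨rfl, rfl⟩ := hp
      exact hm
    · simp [ps] at hp
  have hl : l.Nodup := he.of_map _
  have hpl : (pw l).Nodup := by
    refine hl.filterMap ?_
    rintro ⟨f | u, d⟩ ⟨f' | u', d'⟩ b h h' <;> simp_all [ps]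
    rw [← h'] at h
    simp only [Option.some.injEq, Prod.mk.injEq] at h
    rw [h.1, h.2]
  refine ⟨?_, ?_, ?_⟩
  · intro hnil
    have hall : ∀ s ∈ l, s.1 = (Sum.inr () : Γ.E ⊕ Unit) := by
      rintro ⟨f | u, d⟩ hm
      · have : (f, d) ∈ pw l := List.mem_filterMap.mpr ⟨_, hm, rfl⟩
        rw [hnil] at this
        simp at this
      · rfl
    match l, h0, he, hw, hall with
    | [], h0, _, _, _ => exact h0 rfl
    | [s], _, _, hw, hall =>
      obtain ⟨e, d⟩ := s
      have : e = (Sum.inr () : Γ.E ⊕ Unit) := hall (e, d) (by simp)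
      subst this
      cases hw with
      | cons h1 h2 =>
      have h3 : (Γ.extrude v w F).stepEnd (Sum.inr (), d) = a := by
        generalize (Γ.extrude v w F).stepEnd (Sum.inr (), d) = z at h2
        cases h2
        rfl
      have h4 := h1.trans h3.symm
      cases d <;> simp [stepStart, stepEnd, extrude] at h4
    | s :: s' :: l, _, he, _, hall =>
      have e1 := hall s (by simp)
      have e2 := hall s' (by simp)
      simp [walkEdges] at he
      exact he.1.1 (e1.trans e2.symm)
  · refine hpl.map_on ?_
    rintro ⟨e, d⟩ h ⟨e', d'⟩ h' heq
    have heq : e = e' := heq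
    subst heq
    have := List.inj_on_of_nodup_map he (hmem h) (hmem h') rfl
    rw [(Prod.mk.inj this).2]
  · refine hpl.map_on ?_
    rintro ⟨e, d⟩ h ⟨e', d'⟩ h' heq
    rw [pv_start (v := v) (w := w) (F := F), pv_start (v := v) (w := w) (F := F)] at heq
    have key : (Γ.extrude v w F).stepStart (Sum.inl e, d) =
        (Γ.extrude v w F).stepStart (Sum.inl e', d') := by
      rcases hx : (Γ.extrude v w F).stepStart (Sum.inl e, d) with x | x <;>
      rcases hy : (Γ.extrude v w F).stepStart (Sum.inl e', d') with y | y
      · rw [hx, hy] at heq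
        exact congrArg Sum.inl heq
      · rw [hx, hy] at heq
        have heq : x = v := heq
        subst heq
        exact (no_bad hF hw hn (hmem h) (hmem h') hx hy).elim
      · rw [hx, hy] at heq
        have heq : v = y := heq
        subst heq
        exact (no_bad hF hw hn (hmem h') (hmem h) hy hx).elim
      · rfl
    have := List.inj_on_of_nodup_map hn (hmem h) (hmem h') key
    rw [Sum.inl.inj (Prod.mk.inj this).1, (Prod.mk.inj this).2]

/-- Projection of chains. -/
def pc : (((Γ.E ⊕ Unit) →₀ ZMod 2)) →ₗ[ZMod 2] (Γ.E →₀ ZMod 2) :=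
  Finsupp.lcomapDomain Sum.inl Sum.inl_injective

theorem pc_apply (c : (Γ.E ⊕ Unit) →₀ ZMod 2) (e : Γ.E) : pc c e = c (Sum.inl e) := rfl

/-- The boundary map of the extruded graph, with unfolded types. -/
def bd (v w : Γ.V) (F : Set Γ.E) :
    ((Γ.E ⊕ Unit) →₀ ZMod 2) →ₗ[ZMod 2] ((Γ.V ⊕ Unit) →₀ ZMod 2) :=
  (Γ.extrude v w F).boundary

theorem boundary_single (Γ : MGraph) (e : Γ.E) (x : ZMod 2) :
    Γ.boundary (Finsupp.single e x) =
      Finsupp.single (Γ.src e) x + Finsupp.single (Γ.tgt e) x := by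
  simp [boundary]

/-- Source map with unfolded types. -/
def sr (v w : Γ.V) (F : Set Γ.E) : Γ.E ⊕ Unit → Γ.V ⊕ Unit := (Γ.extrude v w F).src

/-- Target map with unfolded types. -/
def tg (v w : Γ.V) (F : Set Γ.E) : Γ.E ⊕ Unit → Γ.V ⊕ Unit := (Γ.extrude v w F).tgt

theorem bd_single (e : Γ.E ⊕ Unit) (x : ZMod 2) :
    bd v w F (Finsupp.single e x) =
      Finsupp.single (sr v w F e) x + Finsupp.single (tg v w F e) x :=
  boundary_single (Γ.extrude v w F) e x

theorem boundary_pc (c : (Γ.E ⊕ Unit) →₀ ZMod 2) :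
    Γ.boundary (pc c) = Finsupp.mapDomain (pv v) (bd v w F c) := by
  induction c using Finsupp.induction_linear with
  | zero => simp
  | add f g hf hg =>
    rw [map_add, map_add, hf, hg, map_add, Finsupp.mapDomain_add]
  | single a x =>
    rw [bd_single, Finsupp.mapDomain_add, Finsupp.mapDomain_single, Finsupp.mapDomain_single]
    rcases a with e | u
    · have : pc (Finsupp.single (Sum.inl e : Γ.E ⊕ Unit) x) = Finsupp.single e x := by
        ext f
        simp [pc_apply, Finsupp.single_apply]
      have h1 : pv v (sr v w F (Sum.inl e)) = Γ.src e := pv_src e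
      have h2 : pv v (tg v w F (Sum.inl e)) = Γ.tgt e := pv_tgt e
      rw [this, boundary_single, h1, h2]
    · have : pc (Finsupp.single (Sum.inr u : Γ.E ⊕ Unit) x) = 0 := by
        ext f
        simp [pc_apply]
      rw [this, map_zero]
      change 0 = Finsupp.single v x + Finsupp.single v x
      rw [← Finsupp.single_add, CharTwo.add_self_eq_zero, Finsupp.single_zero]

theorem pc_mem {c : (Γ.E ⊕ Unit) →₀ ZMod 2} (hc : c ∈ (Γ.extrude v w F).cycleSpace) :
    pc c ∈ Γ.cycleSpace := by
  have hc : bd v w F c = 0 := hc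
  change Γ.boundary (pc c) = 0
  rw [boundary_pc (v := v) (w := w) (F := F), hc]
  exact Finsupp.mapDomain_zero

theorem bd_new (x : ZMod 2) :
    bd v w F (Finsupp.single (Sum.inr () : Γ.E ⊕ Unit) x) (Sum.inr ()) = x := by
  rw [bd_single]
  have h1 : sr v w F (Sum.inr ()) = Sum.inl v := rfl
  have h2 : tg v w F (Sum.inr ()) = Sum.inr () := rfl
  rw [h1, h2]
  simp

theorem pc_inj {c : (Γ.E ⊕ Unit) →₀ ZMod 2} (hc : c ∈ (Γ.extrude v w F).cycleSpace)
    (h : pc c = 0) : c = 0 := by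
  have h1 : c = Finsupp.single (Sum.inr ()) (c (Sum.inr ())) := by
    ext a
    rcases a with e | u
    · have := DFunLike.congr_fun h e
      rw [pc_apply] at this
      simpa using this
    · simp
  have hc : bd v w F c = 0 := hc
  have h2 := bd_new (v := v) (w := w) (F := F) (c (Sum.inr ()))
  rw [← h1, hc] at h2
  rw [h1, ← h2]
  simp

theorem pc_surj {d : Γ.E →₀ ZMod 2} (hd : d ∈ Γ.cycleSpace) :
    ∃ c : (Γ.E ⊕ Unit) →₀ ZMod 2, c ∈ (Γ.extrude v w F).cycleSpace ∧ pc c = d := by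
  let c₀ : (Γ.E ⊕ Unit) →₀ ZMod 2 := Finsupp.mapDomain Sum.inl d
  let x : ZMod 2 := bd v w F c₀ (Sum.inr ())
  let c : (Γ.E ⊕ Unit) →₀ ZMod 2 := c₀ + Finsupp.single (Sum.inr ()) x
  have hpc : pc c = d := by
    ext e
    rw [pc_apply]
    simp only [c, c₀, Finsupp.add_apply]
    rw [Finsupp.mapDomain_apply Sum.inl_injective]
    simp
  refine ⟨c, ?_, hpc⟩
  have hd : Γ.boundary d = 0 := hd
  have h1 := boundary_pc (v := v) (w := w) (F := F) c
  rw [hpc, hd] at h1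
  have h2 : bd v w F c (Sum.inr ()) = 0 := by
    rw [map_add, Finsupp.add_apply, bd_new]
    exact CharTwo.add_self_eq_zero x
  change bd v w F c = 0
  generalize bd v w F c = z at h1 h2
  have hz : z = Finsupp.mapDomain Sum.inl (Finsupp.mapDomain (pv v) z) := by
    rw [← Finsupp.mapDomain_comp]
    conv_lhs => rw [← Finsupp.mapDomain_id (v := z)]
    refine Finsupp.mapDomain_congr ?_
    rintro (y | y) hy
    · rfl
    · exact absurd h2 (Finsupp.mem_support_iff.mp hy)
  rw [← h1] at hz
  exact hz.trans Finsupp.mapDomain_zero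

theorem basis_image {B : Set ((Γ.E ⊕ Unit) →₀ ZMod 2)}
    (hB : (Γ.extrude v w F).IsCycleBasis B) : Γ.IsCycleBasis (pc '' B) := by
  obtain ⟨h1, h2, h3⟩ := hB
  refine ⟨?_, ?_, ?_⟩
  · rintro _ ⟨c, hc, rfl⟩
    exact pc_mem (h1 c hc)
  · have h2' : LinearIndependent (ZMod 2) (fun c : B => c.1) := h2
    have h4 := h2'.map (f := pc) (by
      rw [Submodule.disjoint_def]
      intro x hx hk
      rw [Subtype.range_coe_subtype, Set.ofPred_mem_eq] at hx
      have hx' : x ∈ (Γ.extrude v w F).cycleSpace := (Submodule.span_le.mpr h1) hx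
      exact pc_inj hx' hk)
    have h5 : LinearIndepOn (ZMod 2) pc B := h4
    exact h5.id_image
  · intro d hd
    obtain ⟨c, hc, rfl⟩ := pc_surj (v := v) (w := w) (F := F) hd
    rw [Submodule.span_image]
    exact Submodule.mem_map_of_mem (h3 c hc)

end

end Extr

end MGraph

end

open MGraph MGraph.Extr in
/-- For a subgroup-closed class `𝒢` and a loopless graph `Γ` for
which the Circle Test is valid with respect to `𝒢`, extruding a vertex of `Γ`
preserves validity of the Circle Test with respect to `𝒢`. -/
theorem circle_test_extrusion (𝒢 : GroupClass) (hsub : SubgroupClosed 𝒢)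
    (Γ : MGraph) (hloop : Γ.Loopless) (h : Γ.CircleTestValidFor 𝒢)
    (v w : Γ.V) (F : Set Γ.E) (hF : Γ.IsExtrusionData v w F) :
    (Γ.extrude v w F).CircleTestValidFor 𝒢 := by
  intro G _ hG g ⟨B, hB, hbal⟩
  have hΓ : Γ.IsBalanced (hg g) := by
    refine h G hG (hg g) ⟨pc '' B, basis_image hB, ?_⟩
    rintro _ ⟨c, hc, rfl⟩
    obtain ⟨l, hl, ⟨⟨a, hw⟩, hcount⟩, hgain⟩ := hbal c hc
    refine ⟨pw l, pw_simple hF hw hl, ⟨⟨_, pw_walk hw⟩, ?_⟩, ?_⟩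
    · intro e
      rw [pw_count, pc_apply]
      exact hcount (Sum.inl e)
    · rw [pw_gain g hw, hgain]
      simp
  intro a l hw hl
  have := hΓ _ _ (pw_walk hw) (pw_simple hF hw hl)
  rw [pw_gain g hw] at this
  rwa [conj_eq_one_iff] at this
end

section
/- Let M₁, M₂, … be a list of finite graphs such that (i) every vertex of each Mᵢ has at least two neighbors, (ii) no Mᵢ has a loop, and (iii) each Mᵢ is extrusion-irreducible. If Γ is a finite graph with no minor isomorphic to any Mᵢ, then any graph obtained from Γ by extruding a vertex also has no minor isomorphic to any Mᵢ. -/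
set_option maxHeartbeats 1000000
set_option synthInstance.maxHeartbeats 400000

attribute [local instance] Classical.propDecidable

namespace MGraph

/-- Splitting off one point of a type. -/
noncomputable def splitPt {α : Type} (a : α) : α ≃ {x : α // x ≠ a} ⊕ Unit where
  toFun x := if h : x = a then Sum.inr () else Sum.inl ⟨x, h⟩
  invFun y := Sum.elim (fun x => x.1) (fun _ => a) y
  left_inv x := by by_cases h : x = a <;> simp [h]
  right_inv y := by
    rcases y with ⟨x, hx⟩ | u
    · simp [hx]
    · simp

theorem splitPt_self {α : Type} (a : α) : splitPt a a = Sum.inr () := by simp [splitPt]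

theorem splitPt_ne {α : Type} (a x : α) (h : x ≠ a) : splitPt a x = Sum.inl ⟨x, h⟩ := by
  simp [splitPt, h]

/-- The class of a vertex in a contraction. -/
def cls (Γ : MGraph) (S : Set Γ.E) (x : Γ.V) : Quot (Γ.contractRel S) := Quot.mk _ x

theorem cls_edge (Γ : MGraph) (S : Set Γ.E) (e : Γ.E) (he : e ∈ S) :
    Γ.cls S (Γ.src e) = Γ.cls S (Γ.tgt e) := Quot.sound ⟨e, he, rfl, rfl⟩

/-- A minor model. -/
def Model (M Γ : MGraph) (S : Set Γ.E) (α : M.V → Γ.V) (β : M.E → Γ.E) : Prop :=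
  (∀ x y, Γ.cls S (α x) = Γ.cls S (α y) → x = y) ∧ Function.Injective β ∧ (∀ e, β e ∉ S) ∧
  ∀ e, s(Γ.cls S (Γ.src (β e)), Γ.cls S (Γ.tgt (β e)))
    = s(Γ.cls S (α (M.src e)), Γ.cls S (α (M.tgt e)))

theorem model_of_isMinor {M Γ : MGraph} (h : M.IsMinor Γ) :
    ∃ S α β, Model M Γ S α β := by
  obtain ⟨S, U, T, ⟨φ⟩⟩ := h
  have hr : ∀ q : Quot (Γ.contractRel S), Γ.cls S (Quot.out q) = q := fun q => Quot.out_eq q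
  refine ⟨S, fun x => Quot.out (φ.vEquiv x).1, fun e => (φ.eEquiv e).1.1, ?_, ?_, ?_, ?_⟩
  · intro x y hxy
    exact φ.vEquiv.injective (Subtype.ext ((hr _).symm.trans (hxy.trans (hr _))))
  · intro e f hef
    exact φ.eEquiv.injective (Subtype.ext (Subtype.ext hef))
  · intro e
    exact (φ.eEquiv e).1.2
  · intro e
    refine Eq.trans ?_ (congrArg₂ (fun a b => s(a, b)) (hr _) (hr _)).symm
    exact congrArg (Sym2.map Subtype.val) (φ.ends_eq e)

theorem isMinor_of_model {M Γ : MGraph} {S : Set Γ.E} {α : M.V → Γ.V} {β : M.E → Γ.E}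
    (h : Model M Γ S α β) : M.IsMinor Γ := by
  obtain ⟨h1, h2, h3, h4⟩ := h
  let a : M.V → (Γ.contract S).V := fun x => Γ.cls S (α x)
  let b : M.E → (Γ.contract S).E := fun e => ⟨β e, h3 e⟩
  have ha : Function.Injective a := fun x y hxy => h1 x y hxy
  have hb : Function.Injective b := fun x y hxy => h2 (congrArg Subtype.val hxy)
  have h4' : ∀ e, s((Γ.contract S).src (b e), (Γ.contract S).tgt (b e))
    = s(a (M.src e), a (M.tgt e)) := h4
  have hs : ∀ e, (Γ.contract S).src (b e) ∈ Set.range a ∧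
      (Γ.contract S).tgt (b e) ∈ Set.range a := by
    intro e
    rcases Sym2.eq_iff.1 (h4' e) with ⟨p, q⟩ | ⟨p, q⟩
    · exact ⟨⟨_, p.symm⟩, ⟨_, q.symm⟩⟩
    · exact ⟨⟨_, p.symm⟩, ⟨_, q.symm⟩⟩
  let b' : M.E → ((Γ.contract S).subgraph (Set.range a) (Set.range b)).E :=
    fun e => ⟨b e, ⟨e, rfl⟩, (hs e).1, (hs e).2⟩
  have hb' : Function.Bijective b' := by
    constructor
    · intro x y hxy
      exact hb (congrArg Subtype.val hxy)
    · rintro ⟨_, ⟨e, rfl⟩, _⟩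
      exact ⟨e, rfl⟩
  refine ⟨S, Set.range a, Set.range b, ⟨⟨Equiv.ofInjective a ha, Equiv.ofBijective b' hb', ?_⟩⟩⟩
  intro e
  apply Sym2.map.injective Subtype.val_injective
  exact h4' e

/-- Transfer of minor models. -/
theorem Model.transfer {M Γ Γ' : MGraph} {S : Set Γ'.E} {α : M.V → Γ'.V} {β : M.E → Γ'.E}
    (hm : Model M Γ' S α β) (S' : Set Γ.E) (h : Γ.V → Γ'.V) (k : Γ'.V → Γ.V)
    (hh : ∀ e ∈ S', Γ'.cls S (h (Γ.src e)) = Γ'.cls S (h (Γ.tgt e)))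
    (hk : ∀ e ∈ S, Γ.cls S' (k (Γ'.src e)) = Γ.cls S' (k (Γ'.tgt e)))
    (hhk : ∀ x, Γ'.cls S (h (k (α x))) = Γ'.cls S (α x))
    (β' : M.E → Γ.E) (hi : Function.Injective β') (hS : ∀ e, β' e ∉ S')
    (hβ : ∀ e, k (Γ'.src (β e)) = Γ.src (β' e) ∧ k (Γ'.tgt (β e)) = Γ.tgt (β' e) ∨
      k (Γ'.src (β e)) = Γ.tgt (β' e) ∧ k (Γ'.tgt (β e)) = Γ.src (β' e)) :
    M.IsMinor Γ := by
  obtain ⟨h1, h2, h3, h4⟩ := hm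
  let H : Quot (Γ.contractRel S') → Quot (Γ'.contractRel S) :=
    Quot.lift (fun x => Γ'.cls S (h x)) (by rintro _ _ ⟨e, he, rfl, rfl⟩; exact hh e he)
  let K : Quot (Γ'.contractRel S) → Quot (Γ.contractRel S') :=
    Quot.lift (fun x => Γ.cls S' (k x)) (by rintro _ _ ⟨e, he, rfl, rfl⟩; exact hk e he)
  refine isMinor_of_model (S := S') (α := fun x => k (α x)) (β := β') ⟨?_, hi, hS, ?_⟩
  · intro x y hxy
    have : Γ'.cls S (h (k (α x))) = Γ'.cls S (h (k (α y))) := congrArg H hxy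
    rw [hhk, hhk] at this
    exact h1 _ _ this
  · intro e
    have : s(Γ.cls S' (k (Γ'.src (β e))), Γ.cls S' (k (Γ'.tgt (β e)))) =
      s(Γ.cls S' (k (α (M.src e))), Γ.cls S' (k (α (M.tgt e)))) := congrArg (Sym2.map K) (h4 e)
    rw [← this]
    rcases hβ e with ⟨p, q⟩ | ⟨p, q⟩
    · rw [p, q]
    · rw [p, q, Sym2.eq_swap]

/-- `e` joins `x` and `y`. -/
def Joins (M : MGraph) (e : M.E) (x y : M.V) : Prop :=
  (M.src e = x ∧ M.tgt e = y) ∨ (M.src e = y ∧ M.tgt e = x)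

theorem not_irreducible {M : MGraph} {x₀ y₀ z₀ : M.V} {e₀ e₁ : M.E}
    (hxy : y₀ ≠ x₀) (hxz : z₀ ≠ x₀) (hyz : y₀ ≠ z₀)
    (he₀ : M.Joins e₀ x₀ y₀) (he₁ : M.Joins e₁ x₀ z₀)
    (hall : ∀ e, e ≠ e₀ → (M.src e = x₀ ∨ M.tgt e = x₀) → M.Joins e x₀ z₀) :
    ¬ M.ExtrusionIrreducible := by
  intro hirr
  have hne : e₁ ≠ e₀ := by
    rintro rfl
    unfold Joins at *
    grind
  let p : M.V → {x : M.V // x ≠ x₀} := fun x => if h : x = x₀ then ⟨y₀, hxy⟩ else ⟨x, h⟩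
  have p0 : p x₀ = ⟨y₀, hxy⟩ := by simp [p]
  have p1 : ∀ x (h : x ≠ x₀), p x = ⟨x, h⟩ := by intro x h; simp [p, h]
  let Δ : MGraph :=
    { V := {x : M.V // x ≠ x₀}
      E := {e : M.E // e ≠ e₀}
      src := fun e => p (M.src e.1)
      tgt := fun e => p (M.tgt e.1) }
  let F : Set Δ.E := {e | M.src e.1 = x₀ ∨ M.tgt e.1 = x₀}
  refine hirr ⟨Δ, ⟨y₀, hxy⟩, ⟨z₀, hxz⟩, F, ⟨?_, ⟨⟨e₁, hne⟩, ?_⟩, ?_⟩,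
    ⟨⟨splitPt x₀, splitPt e₀, ?_⟩⟩⟩
  · intro h
    exact hyz (congrArg Subtype.val h)
  · rcases he₁ with h | h
    · exact Or.inl h.1
    · exact Or.inr h.2
  · rintro ⟨e, he⟩ hF
    rcases hall e he hF with ⟨h, h'⟩ | ⟨h, h'⟩
    · left
      constructor
      · show p (M.src e) = _
        rw [h, p0]
      · show p (M.tgt e) = _
        rw [h', p1 _ hxz]
    · right
      constructor
      · show p (M.src e) = _
        rw [h, p1 _ hxz]
      · show p (M.tgt e) = _
        rw [h', p0]
  · intro e
    have red : ∀ t : (Δ.extrude ⟨y₀, hxy⟩ ⟨z₀, hxz⟩ F).E, splitPt e₀ e = t →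
        s((Δ.extrude ⟨y₀, hxy⟩ ⟨z₀, hxz⟩ F).src t, (Δ.extrude ⟨y₀, hxy⟩ ⟨z₀, hxz⟩ F).tgt t) =
          s(splitPt x₀ (M.src e), splitPt x₀ (M.tgt e)) →
        s((Δ.extrude ⟨y₀, hxy⟩ ⟨z₀, hxz⟩ F).src (splitPt e₀ e),
          (Δ.extrude ⟨y₀, hxy⟩ ⟨z₀, hxz⟩ F).tgt (splitPt e₀ e)) =
          s(splitPt x₀ (M.src e), splitPt x₀ (M.tgt e)) := by
      rintro t rfl h
      exact h
    by_cases he : e = e₀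
    · subst he
      refine red _ (splitPt_self e) ?_
      show s((Sum.inl ⟨y₀, hxy⟩ : {x : M.V // x ≠ x₀} ⊕ Unit), Sum.inr ()) =
        s(splitPt x₀ (M.src e), splitPt x₀ (M.tgt e))
      rcases he₀ with ⟨h, h'⟩ | ⟨h, h'⟩
      · rw [h, h', splitPt_self, splitPt_ne _ _ hxy]; exact Sym2.eq_swap
      · rw [h, h', splitPt_self, splitPt_ne _ _ hxy]
    · refine red _ (splitPt_ne _ _ he) ?_
      have key : ∀ u, (M.src e = u ∨ M.tgt e = u) →
          ∀ d : Decidable ((⟨e, he⟩ : Δ.E) ∈ F ∧ p u = ⟨y₀, hxy⟩),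
          (@ite _ ((⟨e, he⟩ : Δ.E) ∈ F ∧ p u = ⟨y₀, hxy⟩) d (Sum.inr ()) (Sum.inl (p u))) =
            splitPt x₀ u := by
        intro u hu d
        by_cases hux : u = x₀
        · subst hux
          rw [splitPt_self, if_pos ⟨hu, p0⟩]
        · rw [splitPt_ne _ _ hux, if_neg, p1 _ hux]
          rintro ⟨hF, hy⟩
          rw [p1 _ hux] at hy
          have hy' : u = y₀ := congrArg Subtype.val hy
          have := hall e he hF
          unfold Joins at this
          grind
      exact congrArg₂ (fun a b => s(a, b)) (key _ (Or.inl rfl) _) (key _ (Or.inr rfl) _)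

section
variable (Γ : MGraph) (v w : Γ.V) (F : Set Γ.E)

theorem ext_src (f : Γ.E) : (Γ.extrude v w F).src (Sum.inl f) =
    if f ∈ F ∧ Γ.src f = v then Sum.inr () else Sum.inl (Γ.src f) := rfl
theorem ext_tgt (f : Γ.E) : (Γ.extrude v w F).tgt (Sum.inl f) =
    if f ∈ F ∧ Γ.tgt f = v then Sum.inr () else Sum.inl (Γ.tgt f) := rfl
theorem ext_src' (u : Unit) : (Γ.extrude v w F).src (Sum.inr u) = Sum.inl v := rfl
theorem ext_tgt' (u : Unit) : (Γ.extrude v w F).tgt (Sum.inr u) = Sum.inr () := rfl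

theorem ext_F (hF : Γ.IsExtrusionData v w F) (f : Γ.E) (hf : f ∈ F) :
    (Γ.extrude v w F).Joins (Sum.inl f) (Sum.inr ()) (Sum.inl w) := by
  unfold Joins
  rw [ext_src, ext_tgt]
  have h1 := hF.1
  rcases hF.2.2 f hf with ⟨h, h'⟩ | ⟨h, h'⟩
  · left; rw [h, h']; simp [hf, h1.symm]; exact ⟨rfl, rfl⟩
  · right; rw [h, h']; simp [hf, h1.symm]; exact ⟨rfl, rfl⟩

theorem ext_nF (f : Γ.E) (hf : f ∉ F) :
    (Γ.extrude v w F).src (Sum.inl f) = Sum.inl (Γ.src f) ∧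
    (Γ.extrude v w F).tgt (Sum.inl f) = Sum.inl (Γ.tgt f) := by
  rw [ext_src, ext_tgt]; simp [hf]; exact ⟨rfl, rfl⟩

end

/-- Cases with the new vertex merged into `v` (or unused). -/
theorem caseA {M Γ : MGraph} {v w : Γ.V} {F : Set Γ.E}
    {S : Set (Γ.extrude v w F).E} {α : M.V → (Γ.extrude v w F).V}
    {β : M.E → (Γ.extrude v w F).E} (hm : Model M _ S α β)
    (hb : ∀ e, β e ≠ Sum.inr ())
    (hS : (Γ.extrude v w F).cls S (Sum.inr ()) = (Γ.extrude v w F).cls S (Sum.inl v) ∨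
      ((∀ x, α x ≠ Sum.inr ()) ∧ ∀ f ∈ F, Sum.inl f ∉ S)) : M.IsMinor Γ := by
  let k : (Γ.extrude v w F).V → Γ.V := Sum.elim id (fun _ => v)
  have ks : ∀ f, k ((Γ.extrude v w F).src (Sum.inl f)) = Γ.src f := by
    intro f; rw [ext_src]; split_ifs with h
    · exact h.2.symm
    · rfl
  have kt : ∀ f, k ((Γ.extrude v w F).tgt (Sum.inl f)) = Γ.tgt f := by
    intro f; rw [ext_tgt]; split_ifs with h
    · exact h.2.symm
    · rfl
  have hb' : ∀ e, ∃ f : Γ.E, β e = Sum.inl f := by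
    intro e
    rcases h : β e with f | ⟨⟩
    · exact ⟨f, rfl⟩
    · exact absurd h (hb e)
  choose β' hβ' using hb'
  refine hm.transfer {f | Sum.inl f ∈ S} Sum.inl k ?_ ?_ ?_ β' ?_ ?_ ?_
  · intro f hf
    have hf' : (Sum.inl f : (Γ.extrude v w F).E) ∈ S := hf
    have h := cls_edge _ S _ hf'
    rcases hS with hS | ⟨_, hS⟩
    · rw [ext_src, ext_tgt] at h
      split_ifs at h with h1 h2 h2
      · rw [h1.2, h2.2]
      · rw [h1.2, ← hS, h]
      · rw [h2.2, ← hS, h]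
      · exact h
    · have hn : f ∉ F := fun h' => hS f h' hf'
      rw [(ext_nF Γ v w F f hn).1, (ext_nF Γ v w F f hn).2] at h
      exact h
  · rintro (f | ⟨⟩) hf
    · rw [ks, kt]
      exact cls_edge Γ {f | Sum.inl f ∈ S} f hf
    · rfl
  · intro x
    rcases hx : α x with y | ⟨⟩
    · rfl
    · rcases hS with hS | ⟨hS, _⟩
      · exact hS.symm
      · exact absurd hx (hS x)
  · intro e f hef
    apply hm.2.1
    rw [hβ', hβ', hef]
  · intro e he
    apply hm.2.2.1 e
    rw [hβ']
    exact he
  · intro e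
    left
    rw [hβ', ks, kt]
    exact ⟨rfl, rfl⟩

/-- No edge of a loopless minor becomes a loop. -/
theorem Model.noloop {M Γ : MGraph} {S : Set Γ.E} {α : M.V → Γ.V}
    {β : M.E → Γ.E} (hm : Model M Γ S α β) (hl : M.Loopless) (e : M.E) :
    Γ.cls S (Γ.src (β e)) ≠ Γ.cls S (Γ.tgt (β e)) := by
  intro h
  apply hl e
  apply hm.1
  rcases Sym2.eq_iff.1 (hm.2.2.2 e) with ⟨p, q⟩ | ⟨p, q⟩
  · rw [← p, ← q, h]
  · rw [← p, ← q, h]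

/-- The case with the new vertex merged into `w`. -/
theorem caseB {M Γ : MGraph} {v w : Γ.V} {F : Set Γ.E} (hF : Γ.IsExtrusionData v w F)
    {S : Set (Γ.extrude v w F).E} {α : M.V → (Γ.extrude v w F).V}
    {β : M.E → (Γ.extrude v w F).E} (hm : Model M _ S α β) (hl : M.Loopless)
    (hv : (Γ.extrude v w F).cls S (Sum.inr ()) ≠ (Γ.extrude v w F).cls S (Sum.inl v))
    (hw : (Γ.extrude v w F).cls S (Sum.inr ()) = (Γ.extrude v w F).cls S (Sum.inl w)) :
    M.IsMinor Γ := by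
  obtain ⟨f₀, hf₀⟩ := hF.2.1
  let k : (Γ.extrude v w F).V → Γ.V := Sum.elim id (fun _ => w)
  let b : (Γ.extrude v w F).E → Γ.E := Sum.elim id (fun _ => f₀)
  have hbF : ∀ e f, β e = Sum.inl f → f ∉ F := by
    intro e f hef hf
    apply hm.noloop hl e
    rw [hef]
    rcases ext_F Γ v w F hF f hf with ⟨p, q⟩ | ⟨p, q⟩
    · rw [p, q, hw]
    · rw [p, q, hw]
  refine hm.transfer {f | Sum.inl f ∈ S ∧ f ∉ F} Sum.inl k ?_ ?_ ?_ (fun e => b (β e)) ?_ ?_ ?_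
  · rintro f ⟨hf, hn⟩
    have h := cls_edge _ S _ hf
    rw [(ext_nF Γ v w F f hn).1, (ext_nF Γ v w F f hn).2] at h
    exact h
  · rintro (f | ⟨⟩) hf
    · by_cases hn : f ∈ F
      · rcases ext_F Γ v w F hF f hn with ⟨p, q⟩ | ⟨p, q⟩
        · rw [p, q]; rfl
        · rw [p, q]; rfl
      · rw [(ext_nF Γ v w F f hn).1, (ext_nF Γ v w F f hn).2]
        exact cls_edge Γ {f | Sum.inl f ∈ S ∧ f ∉ F} f ⟨hf, hn⟩
    · exact absurd (cls_edge _ S _ hf).symm hv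
  · intro x
    rcases hx : α x with y | ⟨⟩
    · rfl
    · exact hw.symm
  · intro e e' hee
    apply hm.2.1
    have h1 := hbF e
    have h2 := hbF e'
    revert hee h1 h2
    dsimp only
    rcases β e with f | ⟨⟩ <;> rcases β e' with f' | ⟨⟩ <;> intro hee h1 h2
    · exact congrArg Sum.inl hee
    · have h : f = f₀ := hee
      exact absurd (h ▸ hf₀) (h1 f rfl)
    · have h : f₀ = f' := hee
      exact absurd (h ▸ hf₀) (h2 f' rfl)
    · rfl
  · rintro e ⟨he, hn⟩
    rcases h : β e with f | ⟨⟩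
    · apply hm.2.2.1 e
      rw [h] at he ⊢
      exact he
    · apply hn
      rw [h]
      exact hf₀
  · intro e
    rcases h : β e with f | ⟨⟩
    · left
      have hn := hbF e f h
      rw [(ext_nF Γ v w F f hn).1, (ext_nF Γ v w F f hn).2]
      exact ⟨rfl, rfl⟩
    · rcases hF.2.2 f₀ hf₀ with ⟨p, q⟩ | ⟨p, q⟩
      · left; exact ⟨p.symm, q.symm⟩
      · right; exact ⟨q.symm, p.symm⟩

/-- The case with the new vertex a vertex of the minor by itself. -/
theorem caseC {M Γ : MGraph} {v w : Γ.V} {F : Set Γ.E} (hF : Γ.IsExtrusionData v w F)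
    {S : Set (Γ.extrude v w F).E} {α : M.V → (Γ.extrude v w F).V}
    {β : M.E → (Γ.extrude v w F).E} (hm : Model M _ S α β) (hl : M.Loopless)
    (h1 : ∀ x : M.V, ∃ y z : M.V, y ≠ z ∧ M.Adj x y ∧ M.Adj x z)
    (hsing : ∀ y, (Γ.extrude v w F).cls S y = (Γ.extrude v w F).cls S (Sum.inr ()) →
      y = Sum.inr ())
    (x₀ : M.V) (hx₀ : α x₀ = Sum.inr ()) : ¬ M.ExtrusionIrreducible := by
  -- edges at `x₀`
  have key : ∀ e y, M.Joins e x₀ y →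
      (β e = Sum.inr () ∧ (Γ.extrude v w F).cls S (α y) = (Γ.extrude v w F).cls S (Sum.inl v)) ∨
      (β e ≠ Sum.inr () ∧ (Γ.extrude v w F).cls S (α y) =
        (Γ.extrude v w F).cls S (Sum.inl w)) := by
    intro e y he
    have h : s((Γ.extrude v w F).cls S ((Γ.extrude v w F).src (β e)),
        (Γ.extrude v w F).cls S ((Γ.extrude v w F).tgt (β e))) =
        s((Γ.extrude v w F).cls S (Sum.inr ()), (Γ.extrude v w F).cls S (α y)) := by
      rw [hm.2.2.2 e, ← hx₀]
      rcases he with ⟨p, q⟩ | ⟨p, q⟩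
      · rw [p, q]
      · rw [p, q, Sym2.eq_swap]
    rcases hb : β e with f | ⟨⟩
    · right
      refine ⟨Sum.inl_ne_inr, ?_⟩
      rw [hb] at h
      by_cases hf : f ∈ F
      · rcases ext_F Γ v w F hF f hf with ⟨p, q⟩ | ⟨p, q⟩
        · rw [p, q] at h
          exact (Sym2.congr_right.1 h).symm
        · rw [p, q, Sym2.eq_swap] at h
          exact (Sym2.congr_right.1 h).symm
      · rw [(ext_nF Γ v w F f hf).1, (ext_nF Γ v w F f hf).2] at h
        rcases Sym2.eq_iff.1 h with ⟨p, q⟩ | ⟨p, q⟩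
        · exact absurd (hsing _ p) (by simp)
        · exact absurd (hsing _ q) (by simp)
    · left
      refine ⟨rfl, ?_⟩
      rw [hb, ext_src', ext_tgt', Sym2.eq_swap] at h
      exact (Sym2.congr_right.1 h).symm
  have ne : ∀ e y, M.Joins e x₀ y → y ≠ x₀ := by
    rintro e y he rfl
    apply hl e
    rcases he with ⟨p, q⟩ | ⟨p, q⟩ <;> rw [p, q]
  have fin : ∀ e₀ y₀ e₁ z₀, y₀ ≠ z₀ → M.Joins e₀ x₀ y₀ → M.Joins e₁ x₀ z₀ → β e₀ = Sum.inr () →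
      (Γ.extrude v w F).cls S (α z₀) = (Γ.extrude v w F).cls S (Sum.inl w) →
      ¬ M.ExtrusionIrreducible := by
    intro e₀ y₀ e₁ z₀ hyz he₀ he₁ hb hz
    refine not_irreducible (ne _ _ he₀) (ne _ _ he₁) hyz he₀ he₁ ?_
    intro e hee he
    have hu : ∃ u, M.Joins e x₀ u := by
      rcases he with h | h
      · exact ⟨_, Or.inl ⟨h, rfl⟩⟩
      · exact ⟨_, Or.inr ⟨rfl, h⟩⟩
    obtain ⟨u, hu⟩ := hu
    rcases key e u hu with ⟨p, q⟩ | ⟨p, q⟩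
    · exact absurd (hm.2.1 (p.trans hb.symm)) hee
    · have : u = z₀ := hm.1 _ _ (q.trans hz.symm)
      exact this ▸ hu
  obtain ⟨y, z, hyz, ⟨e, he⟩, ⟨e', he'⟩⟩ := h1 x₀
  rcases key e y he with ⟨p, q⟩ | ⟨p, q⟩ <;> rcases key e' z he' with ⟨p', q'⟩ | ⟨p', q'⟩
  · exact absurd (hm.1 _ _ (q.trans q'.symm)) hyz
  · exact fin e y e' z hyz he he' p q'
  · exact fin e' z e y hyz.symm he' he p' q
  · exact absurd (hm.1 _ _ (q.trans q'.symm)) hyz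

end MGraph


/-- Let `M i` be finite graphs such that every vertex of each
`M i` has at least two neighbors, no `M i` has a loop, and each `M i` is
extrusion-irreducible.  If a finite graph `Γ` has no minor isomorphic to any
`M i`, then any graph obtained from `Γ` by extruding a vertex also has no minor
isomorphic to any `M i`. -/
theorem extrusion_preserves_excluded_minors {ι : Type} (M : ι → MGraph)
    (hfin : ∀ i, (M i).IsFiniteGraph)
    (h1 : ∀ i, ∀ x : (M i).V, ∃ y z : (M i).V, y ≠ z ∧ (M i).Adj x y ∧ (M i).Adj x z)
    (h2 : ∀ i, (M i).Loopless)
    (h3 : ∀ i, MGraph.ExtrusionIrreducible (M i))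
    (Γ : MGraph) (hΓ : Γ.IsFiniteGraph)
    (hminor : ∀ i, ¬ (M i).IsMinor Γ)
    (v w : Γ.V) (F : Set Γ.E) (hF : Γ.IsExtrusionData v w F) :
    ∀ i, ¬ (M i).IsMinor (Γ.extrude v w F) := by
  intro i hi
  obtain ⟨S, α, β, hm⟩ := MGraph.model_of_isMinor hi
  have hl := h2 i
  by_cases hv : (Γ.extrude v w F).cls S (Sum.inr ()) = (Γ.extrude v w F).cls S (Sum.inl v)
  · refine hminor i (MGraph.caseA hm ?_ (Or.inl hv))
    intro e he
    apply hm.noloop hl e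
    rw [he]
    exact hv.symm
  by_cases hw : (Γ.extrude v w F).cls S (Sum.inr ()) = (Γ.extrude v w F).cls S (Sum.inl w)
  · exact hminor i (MGraph.caseB hF hm hl hv hw)
  have hFS : ∀ f ∈ F, Sum.inl f ∉ S := by
    intro f hf hfS
    have h := MGraph.cls_edge _ S _ hfS
    rcases MGraph.ext_F Γ v w F hF f hf with ⟨p, q⟩ | ⟨p, q⟩
    · rw [p, q] at h; exact hw h
    · rw [p, q] at h; exact hw h.symm
  have hsing : ∀ y, (Γ.extrude v w F).cls S y = (Γ.extrude v w F).cls S (Sum.inr ()) →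
      y = Sum.inr () := by
    let P : Quot ((Γ.extrude v w F).contractRel S) → Prop :=
      Quot.lift (fun y => y = Sum.inr ()) (by
        rintro _ _ ⟨f | ⟨⟩, he, rfl, rfl⟩
        · have hn : f ∉ F := fun h => hFS f h he
          rw [(MGraph.ext_nF Γ v w F f hn).1, (MGraph.ext_nF Γ v w F f hn).2]
          simp
        · exact absurd (MGraph.cls_edge _ S _ he).symm hv)
    intro y hy
    have : (y = Sum.inr ()) = ((Sum.inr () : (Γ.extrude v w F).V) = Sum.inr ()) :=
      congrArg P hy
    rw [this]
  by_cases hx : ∃ x, α x = Sum.inr ()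
  · obtain ⟨x, hx⟩ := hx
    exact MGraph.caseC hF hm hl (h1 i) hsing x hx (h3 i)
  · push Not at hx
    refine hminor i (MGraph.caseA hm ?_ (Or.inr ⟨hx, hFS⟩))
    intro e he
    have h := hm.2.2.2 e
    rw [he] at h
    rcases Sym2.eq_iff.1 h with ⟨_, q⟩ | ⟨_, q⟩
    · exact hx _ (hsing _ q.symm)
    · exact hx _ (hsing _ q.symm)
end

section
/- Let 𝒢 be the class of all groups, or any class of groups containing a nontrivial group of odd order. Then the forbidden minors for validity of the Binary Cycle Test with respect to 𝒢 form exactly the set {K₁°}, where K₁° is the graph with one vertex and one loop. That is: the Binary Cycle Test is invalid for some gain graph on K₁° with gain group in 𝒢 (in particular, it fails for gain group ℤ_k with k odd, k ≥ 3, gain a generator, with the cyclic orientation traversing the loop k times), while every finite graph having no K₁° minor (i.e., every forest) has valid Binary Cycle Test with respect to 𝒢. -/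
set_option maxHeartbeats 1000000
set_option synthInstance.maxHeartbeats 400000

attribute [local instance] Classical.propDecidable

theorem bct_walk_quot (Γ : MGraph) (S : Set Γ.E) {a b : Γ.V} {l : List Γ.Step}
    (h : Γ.IsWalkFrom a b l) (hS : ∀ s ∈ l, s.1 ∈ S) :
    Quot.mk (Γ.contractRel S) a = Quot.mk (Γ.contractRel S) b := by
  induction h with
  | nil v => rfl
  | @cons a b s l hs hw ih =>
    rw [← ih (fun t ht => hS t (List.mem_cons_of_mem _ ht))]
    have hm : s.1 ∈ S := hS s List.mem_cons_self
    obtain ⟨e, d⟩ := s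
    cases d
    · simp only [MGraph.stepStart, MGraph.stepEnd] at hs ⊢
      simp at hs ⊢
      subst hs
      exact (Quot.sound ⟨e, hm, rfl, rfl⟩).symm
    · simp only [MGraph.stepStart, MGraph.stepEnd] at hs ⊢
      simp at hs ⊢
      subst hs
      exact Quot.sound ⟨e, hm, rfl, rfl⟩

/-- A graph with a simple closed walk has a loop minor. -/
theorem bct_minor (Γ : MGraph) (v : Γ.V) (l : List Γ.Step)
    (hw : Γ.IsWalkFrom v v l) (hl : Γ.IsSimpleClosed l) : MGraph.loopGraph.IsMinor Γ := by
  obtain ⟨hne, hnd, -⟩ := hl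
  cases hw with
  | nil => exact absurd rfl hne
  | @cons _ _ s l hs hw =>
    simp only [MGraph.walkEdges, List.map_cons, List.nodup_cons] at hnd
    let S : Set Γ.E := {e | e ∈ l.map Prod.fst}
    have hq := bct_walk_quot Γ S hw (fun t ht => List.mem_map_of_mem ht)
    have hsS : s.1 ∉ S := hnd.1
    have hloop : Quot.mk (Γ.contractRel S) (Γ.src s.1)
        = Quot.mk (Γ.contractRel S) (Γ.tgt s.1) := by
      rw [← hs] at hq
      obtain ⟨e, d⟩ := s
      cases d <;> simp [MGraph.stepStart, MGraph.stepEnd] at hq ⊢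
      · exact hq
      · exact hq.symm
    let e₀ : (Γ.contract S).E := ⟨s.1, hsS⟩
    let q : (Γ.contract S).V := Quot.mk (Γ.contractRel S) (Γ.src s.1)
    have h1 : (Γ.contract S).src e₀ = q := rfl
    have h2 : (Γ.contract S).tgt e₀ = q := hloop.symm
    refine ⟨S, {q}, {e₀}, ⟨⟨⟨fun _ => ⟨q, rfl⟩, fun _ => (), fun _ => rfl, ?_⟩,
      ⟨fun _ => ⟨e₀, rfl, h1, h2⟩, fun _ => (), fun _ => rfl, ?_⟩, ?_⟩⟩⟩
    · rintro ⟨x, hx⟩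
      exact Subtype.ext (Eq.symm hx)
    · rintro ⟨x, hx⟩
      exact Subtype.ext (Eq.symm hx.1)
    · intro e
      have h3 : ∀ x y : (({q} : Set (Γ.contract S).V)), x = y := by
        rintro ⟨x, hx⟩ ⟨y, hy⟩
        exact Subtype.ext (Eq.trans hx (Eq.symm hy))
      exact congrArg₂ (fun a b => s(a, b)) (h3 _ _) (h3 _ _)

/-- A nontrivial element of odd order defeats the test on the loop. -/
theorem bct_loop {G : Type} [Group G] (x : G) (hx : x ≠ 1) (k : ℕ) (hk : Odd k)
    (hxk : x ^ k = 1) :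
    (∃ B, MGraph.loopGraph.IsCycleBasis B ∧
      MGraph.loopGraph.PassesBCT (fun _ => x) B) ∧
    ¬ MGraph.loopGraph.IsBalanced (fun _ => x) := by
  have hwalk : ∀ n : ℕ, MGraph.loopGraph.IsWalkFrom () () (List.replicate n ((), true)) := by
    intro n
    induction n with
    | zero => exact .nil _
    | succ n ih => exact .cons rfl ih
  constructor
  · refine ⟨{Finsupp.single () 1}, ⟨?_, ?_, ?_⟩, ?_⟩
    · rintro c rfl
      simp only [MGraph.cycleSpace, LinearMap.mem_ker, MGraph.boundary]
      simp only [Finsupp.lsum_single, LinearMap.add_apply, Finsupp.lsingle_apply]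
      rw [← Finsupp.single_add, CharTwo.add_self_eq_zero (1 : ZMod 2), Finsupp.single_zero]
    · have : (Finsupp.single () 1 : Unit →₀ ZMod 2) ≠ 0 := by simp
      exact LinearIndepOn.singleton (v := id) this
    · intro c _
      rw [Submodule.mem_span_singleton]
      refine ⟨c (), ?_⟩
      ext
      simp
    · rintro c rfl
      refine ⟨List.replicate k ((), true), ⟨⟨(), hwalk k⟩, ?_⟩, ?_⟩
      · intro e
        have h1 : ((k : ℕ) : ZMod 2) = 1 := (ZMod.natCast_eq_one_iff_odd).2 hk
        simp [countIn, MGraph.walkEdges, h1]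
      · simp [MGraph.walkGain, MGraph.stepGain, hxk]
  · intro h
    have := h () [((), true)] (hwalk 1) ⟨by simp, by simp [MGraph.walkEdges], by simp⟩
    simp [MGraph.walkGain, MGraph.stepGain] at this
    exact hx this

theorem bct_zmod (k : ℕ) (hk : Odd k) (h3 : 3 ≤ k) :
    ∃ g : MGraph.loopGraph.E → Multiplicative (ZMod k),
      (∃ B, MGraph.loopGraph.IsCycleBasis B ∧ MGraph.loopGraph.PassesBCT g B) ∧
      ¬ MGraph.loopGraph.IsBalanced g := by
  haveI : Fact (1 < k) := ⟨by omega⟩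
  refine ⟨fun _ => Multiplicative.ofAdd 1, bct_loop _ ?_ k hk ?_⟩
  · intro h
    exact one_ne_zero (α := ZMod k) (Multiplicative.ofAdd.injective h)
  · rw [← ofAdd_nsmul]
    simp

/-- If `𝒢` is the class of all groups, or any class containing a
nontrivial group of odd order, then `{K₁°}` is the set of forbidden minors for
validity of the Binary Cycle Test with respect to `𝒢`: the test is invalid for
some gain graph on `K₁°` with gain group in `𝒢` (in particular it fails on `K₁°`
with gain group `ℤ_k` for every odd `k ≥ 3`), while the test is valid, with
respect to `𝒢`, for every finite graph having no `K₁°` minor. -/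
theorem fm_binary_cycle_test (𝒢 : GroupClass)
    (h𝒢 : (∀ (G : Type) (instG : Group G), 𝒢 G instG) ∨
      (∃ (G : Type) (instG : Group G), 𝒢 G instG ∧ 1 < Nat.card G ∧ Odd (Nat.card G))) :
    (¬ MGraph.loopGraph.BCTValidFor 𝒢) ∧
    (∀ Γ : MGraph, Γ.IsFiniteGraph → ¬ MGraph.loopGraph.IsMinor Γ →
      Γ.BCTValidFor 𝒢) ∧
    (∀ k : ℕ, Odd k → 3 ≤ k →
      ∃ g : MGraph.loopGraph.E → Multiplicative (ZMod k),
        (∃ B, MGraph.loopGraph.IsCycleBasis B ∧ MGraph.loopGraph.PassesBCT g B) ∧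
        ¬ MGraph.loopGraph.IsBalanced g) := by
  refine ⟨?_, ?_, bct_zmod⟩
  · intro hv
    rcases h𝒢 with h | ⟨G, instG, hG, h1, hodd⟩
    · obtain ⟨g, hp, hn⟩ := bct_zmod 3 (by decide) le_rfl
      exact hn (hv _ (h _ _) g hp)
    · haveI : Finite G := Nat.finite_of_card_ne_zero (by omega)
      haveI : Nontrivial G := Finite.one_lt_card_iff_nontrivial.1 h1
      obtain ⟨x, hx⟩ := exists_ne (1 : G)
      obtain ⟨hp, hn⟩ := bct_loop x hx (Nat.card G) hodd pow_card_eq_one'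
      exact hn (hv G hG _ hp)
  · intro Γ _ hm G instG _ g _ v l hw hl
    exact absurd (bct_minor Γ v l hw hl) hm
end
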